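/- arXiv:1204.6152 — 3 statements merged into one kernel-verified Lean document; each statement's English description precedes it below -/
import Mathlib

section
/- Among all n-vertex trees with exactly k leaves (2 ≤ k ≤ n-1), the tree P_{n-k}(⌊k/2⌋, ⌈k/2⌉) uniquely minimizes the number of subtrees, achieving (2^{⌊k/2⌋} + 2^{⌈k/2⌉})(n-k-1) + 2^k + k + C(n-k-1, 2) subtrees. -/
open SimpleGraph

/-- The number of subtrees of a graph `G`. -/
noncomputable def numSubtrees {V : Type*} [Fintype V] (G : SimpleGraph V) : ℕ :=
  {S : Set V | S.Nonempty ∧ (G.induce S).Connected}.ncard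

/-- `P_m(a,b)`: the tree obtained from the path `v_0 v_1 ... v_{m-1}` by attaching `a`
pendant vertices to `v_0` and `b` pendant vertices to `v_{m-1}`. -/
def pathAB (m a b : ℕ) : SimpleGraph (Fin m ⊕ (Fin a ⊕ Fin b)) :=
  SimpleGraph.fromRel (fun p q =>
    match p, q with
    | Sum.inl i, Sum.inl j => (i : ℕ) + 1 = (j : ℕ)
    | Sum.inl i, Sum.inr (Sum.inl _) => (i : ℕ) = 0
    | Sum.inl i, Sum.inr (Sum.inr _) => (i : ℕ) = m - 1
    | _, _ => False)


namespace SubtreeMin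

open Finset

/-- A rooted tree description of a graph: root `r`, parent map `p`, depth `d`. -/
structure Rooted {V : Type*} (G : SimpleGraph V) (r : V) (p : V → V) (d : V → ℕ) : Prop where
  pr : p r = r
  dr : d r = 0
  dp : ∀ v, v ≠ r → d v = d (p v) + 1
  adj : ∀ u v, G.Adj u v ↔ (u ≠ r ∧ p u = v) ∨ (v ≠ r ∧ p v = u)

lemma exists_rooted {V : Type*} (G : SimpleGraph V) (hG : G.IsTree) (r : V) :
    ∃ p d, Rooted G r p d := by
  classical
  have huniq : ∀ v u u', G.Adj u v → G.Adj u' v → G.dist r u + 1 = G.dist r v →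
      G.dist r u' + 1 = G.dist r v → u = u' := by
    intro v u u' h h' hd hd'
    obtain ⟨w, hw⟩ := hG.1.exists_walk_length_eq_dist r u
    obtain ⟨w', hw'⟩ := hG.1.exists_walk_length_eq_dist r u'
    have e := (w.concat h).isPath_of_length_eq_dist (by simp [hw, hd])
    have e' := (w'.concat h').isPath_of_length_eq_dist (by simp [hw', hd'])
    have := (hG.2.subsingleton_path r v).elim ⟨_, e⟩ ⟨_, e'⟩
    have h3 : w.concat h = w'.concat h' := congrArg Subtype.val this
    have := congrArg SimpleGraph.Walk.penultimate h3
    simpa using this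
  have hex : ∀ v, v ≠ r → ∃ u, G.Adj u v ∧ G.dist r u + 1 = G.dist r v := by
    intro v hv
    obtain ⟨w, hw⟩ := hG.1.exists_walk_length_eq_dist v r
    cases w with
    | nil => exact absurd rfl hv
    | @cons _ u _ h q =>
      refine ⟨u, h.symm, ?_⟩
      have h1 := SimpleGraph.dist_le q
      rw [SimpleGraph.dist_comm (u := v)] at hw
      rw [SimpleGraph.dist_comm] at h1
      simp at hw
      rcases hG.dist_eq_dist_add_one_of_adj r h with h2 | h2 <;> omega
  choose! f hf using hex
  refine ⟨fun v => if v = r then r else f v, fun v => G.dist r v, ?_, ?_, ?_, ?_⟩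
  · simp
  · simp
  · intro v hv
    simp [hv, (hf v hv).2]
  · intro u v
    constructor
    · intro h
      rcases hG.dist_eq_dist_add_one_of_adj r h with h2 | h2
      · left
        have hu : u ≠ r := by rintro rfl; simp at h2
        refine ⟨hu, ?_⟩
        simp only [hu, if_false]
        exact huniq u _ _ (hf u hu).1 h.symm (hf u hu).2 h2.symm
      · right
        have hu : v ≠ r := by rintro rfl; simp at h2
        refine ⟨hu, ?_⟩
        simp only [hu, if_false]
        exact huniq v _ _ (hf v hu).1 h (hf v hu).2 h2.symm
    · rintro (⟨h, rfl⟩ | ⟨h, rfl⟩)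
      · simpa [h] using (hf u h).1.symm
      · simpa [h] using (hf v h).1

/-- `v` is a descendant of `x`. -/
def Desc {V : Type*} (p : V → V) (x v : V) : Prop := ∃ n : ℕ, p^[n] v = x

/-- Combinatorial description of connected sets. -/
def TC {V : Type*} (r : V) (p : V → V) (S : Finset V) : Prop :=
  ∃ t ∈ S, ∀ v ∈ S, v ≠ t → v ≠ r ∧ p v ∈ S

section
variable {V : Type*} {G : SimpleGraph V} {r : V} {p : V → V} {d : V → ℕ}

lemma Desc.refl (x : V) : Desc p x x := ⟨0, rfl⟩

lemma Desc.step {x v : V} (h : v ≠ x) : Desc p x v ↔ Desc p x (p v) := by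
  constructor
  · rintro ⟨n, hn⟩
    cases n with
    | zero => exact absurd hn h
    | succ n => exact ⟨n, by simpa using hn⟩
  · rintro ⟨n, hn⟩
    exact ⟨n + 1, by simpa using hn⟩

lemma Rooted.iter_root (h : Rooted G r p d) (n : ℕ) : p^[n] r = r := by
  induction n with
  | zero => rfl
  | succ n ih => rw [Function.iterate_succ_apply, h.pr, ih]

lemma Rooted.not_desc_root (h : Rooted G r p d) {x : V} (hx : x ≠ r) : ¬ Desc p x r := by
  rintro ⟨n, hn⟩
  rw [h.iter_root] at hn
  exact hx hn.symm

lemma Rooted.desc_depth (h : Rooted G r p d) {x v : V} (hx : x ≠ r) (hd : Desc p x v) :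
    v = x ∨ d x < d v := by
  obtain ⟨n, hn⟩ := hd
  induction n generalizing v with
  | zero => left; exact hn
  | succ n ih =>
    right
    have hv : v ≠ r := by
      rintro rfl
      rw [h.iter_root] at hn
      exact hx hn.symm
    have := h.dp v hv
    rcases ih (v := p v) (by simpa using hn) with h1 | h1
    · rw [h1] at this; omega
    · omega

lemma Rooted.desc_antisymm (h : Rooted G r p d) {x v : V} (hx : x ≠ r) (hv : v ≠ r)
    (hd : Desc p x v) (hd' : Desc p v x) : v = x := by
  rcases h.desc_depth hx hd with h1 | h1
  · exact h1
  rcases h.desc_depth hv hd' with h2 | h2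
  · exact h2.symm
  omega

lemma Rooted.connected_iff (h : Rooted G r p d) (S : Finset V) :
    ((S : Set V).Nonempty ∧ (G.induce (S : Set V)).Connected) ↔ TC r p S := by
  constructor
  · rintro ⟨hne, hc⟩
    obtain ⟨t, ht, hmin⟩ := S.exists_min_image d (by simpa using hne)
    refine ⟨t, ht, fun v hv hvt => ?_⟩
    have hvr : v ≠ r := by
      rintro rfl
      have h1 := hmin v hv
      rw [h.dr] at h1
      by_cases htr : t = v
      · exact hvt htr.symm
      · have := h.dp t htr
        omega
    refine ⟨hvr, ?_⟩
    obtain ⟨w⟩ := hc.preconnected ⟨v, hv⟩ ⟨t, ht⟩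
    obtain ⟨e, -, h1, h2⟩ := w.exists_boundary_dart {u | Desc p v u.1} (Desc.refl v) (by
      intro hd
      rcases h.desc_depth hvr hd with h1 | h1
      · exact hvt h1.symm
      · have := hmin v hv
        simp only at h1
        omega)
    have hadj : G.Adj e.fst.1 e.snd.1 := e.adj
    simp only [Set.mem_ofPred_eq] at h1 h2
    rcases (h.adj _ _).1 hadj with ⟨hr, hp⟩ | ⟨hr, hp⟩
    · by_cases hev : e.fst.1 = v
      · rw [hev] at hp
        rw [hp]
        exact e.snd.2
      · rw [Desc.step hev, hp] at h1
        exact absurd h1 h2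
    · by_cases hev : e.snd.1 = v
      · rw [hev] at h2
        exact absurd (Desc.refl v) h2
      · rw [Desc.step hev, hp] at h2
        exact absurd h1 h2
  · rintro ⟨t, ht, hS⟩
    refine ⟨⟨t, ht⟩, ?_⟩
    have key : ∀ n, ∀ v, ∀ hv : v ∈ S, d v = n →
        (G.induce (S : Set V)).Reachable ⟨v, hv⟩ ⟨t, ht⟩ := by
      intro n
      induction n with
      | zero =>
        intro v hv hd
        by_cases hvt : v = t
        · subst hvt; exact SimpleGraph.Reachable.refl _
        · have := h.dp v (hS v hv hvt).1
          omega
      | succ n ih =>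
        intro v hv hd
        by_cases hvt : v = t
        · subst hvt; exact SimpleGraph.Reachable.refl _
        · obtain ⟨h1, h2⟩ := hS v hv hvt
          have := h.dp v h1
          have hadj : (G.induce (S : Set V)).Adj ⟨v, hv⟩ ⟨p v, h2⟩ := by
            simp only [SimpleGraph.comap_adj, Function.Embedding.subtype_apply]
            exact (h.adj _ _).2 (Or.inl ⟨h1, rfl⟩)
          exact hadj.reachable.trans (ih (p v) h2 (by omega))
    have : Nonempty (S : Set V) := ⟨⟨t, ht⟩⟩
    exact ⟨fun a b => (key _ a.1 a.2 rfl).trans (key _ b.1 b.2 rfl).symm⟩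

open Classical in
lemma Rooted.numSubtrees_eq [Fintype V] (h : Rooted G r p d) :
    numSubtrees G = #{S : Finset V | TC r p S} := by
  unfold numSubtrees
  have : {S : Set V | S.Nonempty ∧ (G.induce S).Connected} =
      (fun S : Finset V => (S : Set V)) '' (({S : Finset V | TC r p S} : Finset (Finset V)) :
        Set (Finset V)) := by
    ext S
    simp only [Set.mem_ofPred_eq, Set.mem_image, coe_filter, mem_univ, true_and]
    constructor
    · intro hS
      refine ⟨S.toFinite.toFinset, ?_, by simp⟩
      rw [← h.connected_iff]
      have e : ((S.toFinite.toFinset : Finset V) : Set V) = S := by simp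
      rw [e]
      exact hS
    · rintro ⟨T, hT, rfl⟩
      exact (h.connected_iff T).2 hT
  rw [this, Set.ncard_image_of_injective _ Finset.coe_injective, Set.ncard_coe_finset]

end

section
variable {V : Type*} [Fintype V] {G : SimpleGraph V} {r : V} {p : V → V} {d : V → ℕ}
  {L : Finset V}

open Classical in
/-- Boundary of `S` inside the inner tree. -/
noncomputable def bd (r : V) (p : V → V) (L S : Finset V) : Finset V :=
  {x ∈ Lᶜ.erase r | ¬ (x ∈ S ↔ p x ∈ S)}

open Classical in
/-- Connected sets meeting the inner tree with given boundary. -/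
noncomputable def fam (r : V) (p : V → V) (L B : Finset V) : Finset (Finset V) :=
  {S | TC r p S ∧ (∃ v ∈ S, v ∉ L) ∧ bd r p L S = B}

/-- Lower bound for the number of connected sets with boundary of size `j`. -/
def hh (k : ℕ) : ℕ → ℕ
  | 0 => 2 ^ k
  | 1 => 2 ^ (k / 2) + 2 ^ ((k + 1) / 2)
  | 2 => 1
  | _ => 0

open Classical in
/-- inner vertices satisfying `A` together with leaves `X`. -/
noncomputable def mk (L : Finset V) (A : V → Prop) (X : Finset V) : Finset V :=
  X ∪ univ.filter (fun v => v ∉ L ∧ A v)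

lemma mem_mk_of_notMem {A : V → Prop} {X : Finset V} (hX : X ⊆ L) {v : V} (hv : v ∉ L) :
    v ∈ mk L A X ↔ A v := by
  have : v ∉ X := fun h => hv (hX h)
  simp [mk, hv, this]

lemma mem_mk_of_mem {A : V → Prop} {X : Finset V} {v : V} (hv : v ∈ L) :
    v ∈ mk L A X ↔ v ∈ X := by
  simp [mk, hv]

lemma mk_inj {A : V → Prop} {X Y : Finset V} (hX : X ⊆ L) (hY : Y ⊆ L)
    (h : mk L A X = mk L A Y) : X = Y := by
  ext v
  by_cases hv : v ∈ L
  · rw [← mem_mk_of_mem (A := A) hv, h, mem_mk_of_mem hv]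
  · exact ⟨fun h => absurd (hX h) hv, fun h => absurd (hY h) hv⟩

lemma mk_mem_fam (h : Rooted G r p d) (hL : ∀ v, p v ∉ L) {A : V → Prop} {X B : Finset V}
    (hX : X ⊆ L) (hXA : ∀ l ∈ X, A (p l)) {t : V} (htL : t ∉ L) (htA : A t)
    (hA : ∀ v, v ∉ L → A v → v ≠ t → v ≠ r ∧ A (p v))
    (hB : ∀ x, x ∈ B ↔ (x ≠ r ∧ x ∉ L ∧ ¬ (A x ↔ A (p x)))) :
    mk L A X ∈ fam r p L B := by
  have hrL : r ∉ L := by simpa [h.pr] using hL r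
  simp only [fam, mem_filter, mem_univ, true_and]
  refine ⟨⟨t, (mem_mk_of_notMem hX htL).2 htA, ?_⟩, ⟨t, (mem_mk_of_notMem hX htL).2 htA, htL⟩, ?_⟩
  · intro v hv hvt
    rw [mem_mk_of_notMem hX (hL v)]
    by_cases hvL : v ∈ L
    · rw [mem_mk_of_mem hvL] at hv
      exact ⟨fun e => hrL (e ▸ hvL), hXA v hv⟩
    · rw [mem_mk_of_notMem hX hvL] at hv
      exact hA v hvL hv hvt
  · ext x
    rw [hB]
    simp only [bd, mem_filter, mem_erase, mem_compl, and_assoc]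
    constructor
    · rintro ⟨h1, h2, h3⟩
      rw [mem_mk_of_notMem hX h2, mem_mk_of_notMem hX (hL x)] at h3
      exact ⟨h1, h2, h3⟩
    · rintro ⟨h1, h2, h3⟩
      rw [mem_mk_of_notMem hX h2, mem_mk_of_notMem hX (hL x)]
      exact ⟨h1, h2, h3⟩

lemma Rooted.not_desc_parent (h : Rooted G r p d) {x : V} (hx : x ≠ r) : ¬ Desc p x (p x) := by
  intro hd
  have := h.dp x hx
  rcases h.desc_depth hx hd with h1 | h1
  · rw [h1] at this; omega
  · omega

lemma Rooted.desc_step_iff (h : Rooted G r p d) {x y : V} (hx : x ≠ r) :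
    ¬ (Desc p x y ↔ Desc p x (p y)) ↔ y = x := by
  constructor
  · intro hn
    by_contra hne
    exact hn (Desc.step hne)
  · rintro rfl
    have := h.not_desc_parent hx
    simp [this, Desc.refl]

lemma fam_empty (h : Rooted G r p d) (hL : ∀ v, p v ∉ L) : 2 ^ #L ≤ #(fam r p L ∅) := by
  have hrL : r ∉ L := by simpa [h.pr] using hL r
  rw [← card_powerset]
  apply card_le_card_of_injOn (fun X => mk L (fun _ => True) X)
  · intro X hX
    have hX := mem_powerset.1 (mem_coe.1 hX)
    exact mk_mem_fam h hL hX (by simp) hrL trivial (fun v _ _ hv => ⟨hv, trivial⟩) (by simp)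
  · intro X hX Y hY e
    exact mk_inj (mem_powerset.1 (mem_coe.1 hX)) (mem_powerset.1 (mem_coe.1 hY)) e

open Classical in
lemma fam_one (h : Rooted G r p d) (hL : ∀ v, p v ∉ L) {x : V} (hx : x ≠ r) (hxL : x ∉ L) :
    2 ^ #{l ∈ L | Desc p x l} + 2 ^ #{l ∈ L | ¬ Desc p x l} ≤ #(fam r p L {x}) := by
  have hrL : r ∉ L := by simpa [h.pr] using hL r
  have hd : ∀ l ∈ L, (Desc p x l ↔ Desc p x (p l)) := by
    intro l hl
    exact Desc.step (fun e => hxL (e ▸ hl))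
  set P1 := ({l ∈ L | Desc p x l} : Finset V).powerset with hP1
  set P2 := ({l ∈ L | ¬ Desc p x l} : Finset V).powerset with hP2
  have s1 : ∀ X ∈ P1, X ⊆ L := fun X hX => (mem_powerset.1 hX).trans (filter_subset _ _)
  have s2 : ∀ X ∈ P2, X ⊆ L := fun X hX => (mem_powerset.1 hX).trans (filter_subset _ _)
  have c1 : #(P1.image (mk L (Desc p x))) = 2 ^ #{l ∈ L | Desc p x l} := by
    rw [card_image_of_injOn, hP1, card_powerset]
    intro X hX Y hY e
    exact mk_inj (s1 X hX) (s1 Y hY) e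
  have c2 : #(P2.image (mk L (fun v => ¬ Desc p x v))) = 2 ^ #{l ∈ L | ¬ Desc p x l} := by
    rw [card_image_of_injOn, hP2, card_powerset]
    intro X hX Y hY e
    exact mk_inj (s2 X hX) (s2 Y hY) e
  rw [← c1, ← c2, ← card_union_of_disjoint]
  · apply card_le_card
    intro S hS
    rw [mem_union, mem_image, mem_image] at hS
    rcases hS with ⟨X, hX, rfl⟩ | ⟨X, hX, rfl⟩
    · refine mk_mem_fam h hL (s1 X hX) ?_ hxL (Desc.refl x) ?_ ?_
      · intro l hl
        have := mem_powerset.1 hX hl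
        rw [mem_filter] at this
        exact (hd l this.1).1 this.2
      · intro v _ hv hvx
        exact ⟨fun e => h.not_desc_root hx (e ▸ hv), (Desc.step hvx).1 hv⟩
      · intro y
        rw [h.desc_step_iff hx, mem_singleton]
        constructor
        · rintro rfl; exact ⟨hx, hxL, rfl⟩
        · exact fun h => h.2.2
    · refine mk_mem_fam h hL (s2 X hX) ?_ hrL (h.not_desc_root hx) ?_ ?_
      · intro l hl
        have := mem_powerset.1 hX hl
        rw [mem_filter] at this
        exact fun e => this.2 ((hd l this.1).2 e)
      · intro v _ hv hvx
        refine ⟨hvx, fun e => hv ?_⟩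
        by_cases hvx' : v = x
        · rw [hvx']; exact Desc.refl x
        · exact (Desc.step hvx').2 e
      · intro y
        rw [not_iff_not, h.desc_step_iff hx, mem_singleton]
        constructor
        · rintro rfl; exact ⟨hx, hxL, rfl⟩
        · exact fun h => h.2.2
  · rw [Finset.disjoint_left]
    intro S h1 h2
    rw [mem_image] at h1 h2
    obtain ⟨X, hX, rfl⟩ := h1
    obtain ⟨Y, hY, e⟩ := h2
    have := mem_mk_of_notMem (A := Desc p x) (s1 X hX) hxL
    rw [← e, mem_mk_of_notMem (s2 Y hY) hxL] at this
    tauto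

lemma fam_two_desc (h : Rooted G r p d) (hL : ∀ v, p v ∉ L) {x y : V} (hx : x ≠ r) (hxL : x ∉ L)
    (hy : y ≠ r) (hyL : y ∉ L) (hxy : x ≠ y) (hd : Desc p x y) {B : Finset V}
    (hB : ∀ z, z ∈ B ↔ z = x ∨ z = y) {X : Finset V} (hX : X ⊆ L)
    (hXA : ∀ l ∈ X, Desc p x (p l) ∧ ¬ Desc p y (p l)) :
    mk L (fun v => Desc p x v ∧ ¬ Desc p y v) X ∈ fam r p L B := by
  have hyx : ¬ Desc p y x := fun e => hxy (h.desc_antisymm hx hy hd e).symm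
  refine mk_mem_fam h hL hX hXA hxL ⟨Desc.refl x, hyx⟩ ?_ ?_
  · rintro v _ ⟨h1, h2⟩ hvx
    refine ⟨fun e => h.not_desc_root hx (e ▸ h1), (Desc.step hvx).1 h1, fun e => h2 ?_⟩
    by_cases hvy : v = y
    · rw [hvy]; exact Desc.refl y
    · exact (Desc.step hvy).2 e
  · intro z
    rw [hB]
    have hpx := h.not_desc_parent hx
    have hpy := h.not_desc_parent hy
    have hxx := Desc.refl (p := p) x
    have hyy := Desc.refl (p := p) y
    by_cases hzx : z = x
    · subst hzx
      simp [hx, hxL, hyx, hpx, hxx]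
    · by_cases hzy : z = y
      · subst hzy
        have := (Desc.step hzx).1 hd
        simp [hy, hyL, hpy, hyy, this]
      · rw [← Desc.step hzx, ← Desc.step hzy]
        simp [hzx, hzy]

lemma fam_two (h : Rooted G r p d) (hL : ∀ v, p v ∉ L) {x y : V} (hx : x ≠ r) (hxL : x ∉ L)
    (hy : y ≠ r) (hyL : y ∉ L) (hxy : x ≠ y) {B : Finset V}
    (hB : ∀ z, z ∈ B ↔ z = x ∨ z = y) : 1 ≤ #(fam r p L B) := by
  have hrL : r ∉ L := by simpa [h.pr] using hL r
  rw [Nat.one_le_iff_ne_zero, card_ne_zero]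
  by_cases h1 : Desc p x y
  · exact ⟨_, fam_two_desc h hL hx hxL hy hyL hxy h1 hB (empty_subset L) (by simp)⟩
  by_cases h2 : Desc p y x
  · exact ⟨_, fam_two_desc h hL hy hyL hx hxL hxy.symm h2 (fun z => by rw [hB, or_comm])
      (empty_subset L) (by simp)⟩
  refine ⟨mk L (fun v => ¬ Desc p x v ∧ ¬ Desc p y v) ∅,
    mk_mem_fam h hL (empty_subset L) (by simp) hrL
      ⟨h.not_desc_root hx, h.not_desc_root hy⟩ ?_ ?_⟩
  · rintro v _ ⟨h3, h4⟩ hvr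
    have hvx : v ≠ x := by rintro rfl; exact h3 (Desc.refl _)
    have hvy : v ≠ y := by rintro rfl; exact h4 (Desc.refl _)
    rw [← Desc.step hvx, ← Desc.step hvy]
    exact ⟨hvr, h3, h4⟩
  · intro z
    rw [hB]
    have hpx := h.not_desc_parent hx
    have hpy := h.not_desc_parent hy
    have hxx := Desc.refl (p := p) x
    have hyy := Desc.refl (p := p) y
    by_cases hzx : z = x
    · subst hzx
      have : ¬ Desc p y (p z) := fun e => h2 ((Desc.step hxy).2 e)
      simp [hx, hxL, hpx, hxx, this]
    · by_cases hzy : z = y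
      · subst hzy
        have : ¬ Desc p x (p z) := fun e => h1 ((Desc.step hzx).2 e)
        simp [hy, hyL, hpy, hyy, this]
      · rw [← Desc.step hzx, ← Desc.step hzy]
        simp [hzx, hzy]

lemma two_pow_bal {c e k : ℕ} (h : c + e = k) :
    2 ^ (k / 2) + 2 ^ ((k + 1) / 2) ≤ 2 ^ c + 2 ^ e ∧
      (2 ^ c + 2 ^ e ≤ 2 ^ (k / 2) + 2 ^ ((k + 1) / 2) → c = k / 2 ∨ c = (k + 1) / 2) := by
  wlog hce : c ≤ e generalizing c e
  · have := this (c := e) (e := c) (by omega) (by omega)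
    rw [add_comm (2 ^ c)]
    refine ⟨this.1, fun h => ?_⟩
    rcases this.2 h with h | h <;> omega
  obtain hc | hc : c = k / 2 ∨ c + 1 ≤ k / 2 := by omega
  · have : e = (k + 1) / 2 := by omega
    subst hc
    rw [this]
    simp
  · have he : (k + 1) / 2 + 1 ≤ e := by omega
    have h1 : 2 ^ ((k + 1) / 2 + 1) ≤ 2 ^ e := Nat.pow_le_pow_right (by norm_num) he
    have h2 : 2 ^ (k / 2) ≤ 2 ^ ((k + 1) / 2) := Nat.pow_le_pow_right (by norm_num) (by omega)
    have h3 : 0 < 2 ^ c := by positivity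
    rw [pow_succ] at h1
    constructor
    · omega
    · intro; omega

open Classical in
lemma fam_le (h : Rooted G r p d) (hL : ∀ v, p v ∉ L) {B : Finset V} (hB : B ⊆ Lᶜ.erase r) :
    hh (#L) (#B) ≤ #(fam r p L B) := by
  have hm : ∀ x ∈ B, x ≠ r ∧ x ∉ L := fun x hx => by simpa using hB hx
  rcases hc : #B with _ | _ | _ | j
  · rw [card_eq_zero] at hc
    subst hc
    exact fam_empty h hL
  · simp only [zero_add] at hc
    rw [card_eq_one] at hc
    obtain ⟨x, rfl⟩ := hc
    obtain ⟨h1, h2⟩ := hm x (by simp)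
    refine le_trans ?_ (fam_one h hL h1 h2)
    exact (two_pow_bal (card_filter_add_card_filter_not _)).1
  · simp only [zero_add] at hc
    rw [card_eq_two] at hc
    obtain ⟨x, y, hxy, rfl⟩ := hc
    obtain ⟨h1, h2⟩ := hm x (by simp)
    obtain ⟨h3, h4⟩ := hm y (by simp)
    exact fam_two h hL h1 h2 h3 h4 hxy (by simp)
  · exact Nat.zero_le _

/-- The extremal value. -/
def bound (k m : ℕ) : ℕ :=
  (2 ^ (k / 2) + 2 ^ ((k + 1) / 2)) * (m - 1) + 2 ^ k + k + (m - 1).choose 2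

open Classical in
lemma sum_hh (k : ℕ) (s : Finset V) :
    k + ∑ B ∈ s.powerset, hh k (#B) = bound k (#s + 1) := by
  rw [sum_powerset_apply_card]
  have : ∀ N, ∑ j ∈ range (N + 1), N.choose j • hh k j =
      2 ^ k + N * (2 ^ (k / 2) + 2 ^ ((k + 1) / 2)) + N.choose 2 := by
    intro N
    rcases N with _ | _ | N
    · simp [hh]
    · simp [sum_range_succ, hh]
    · rw [show N + 1 + 1 + 1 = 3 + N by ring, sum_range_add, sum_eq_zero (s := range N)]
      · simp [sum_range_succ, hh]
      · intro j _
        rw [show 3 + j = j + 1 + 1 + 1 by ring]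
        simp [hh]
  rw [this, bound]
  simp only [Nat.add_sub_cancel]
  ring

open Classical in
lemma total (h : Rooted G r p d) :
    #L + ∑ B ∈ (Lᶜ.erase r).powerset, #(fam r p L B) ≤ numSubtrees G := by
  rw [h.numSubtrees_eq]
  have h1 : ∑ B ∈ (Lᶜ.erase r).powerset, #(fam r p L B) =
      #{S : Finset V | TC r p S ∧ ∃ v ∈ S, v ∉ L} := by
    rw [card_eq_sum_card_fiberwise (f := bd r p L) (t := (Lᶜ.erase r).powerset)]
    · apply sum_congr rfl
      intro B _
      rw [fam, filter_filter]
      congr 1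
      ext S
      simp [and_assoc]
    · intro S _
      simp only [coe_powerset, Set.mem_preimage, Set.mem_powerset_iff, coe_subset]
      exact filter_subset _ _
  have h2 : #L = #(L.image (fun l => ({l} : Finset V))) := by
    rw [card_image_of_injective _ singleton_injective]
  rw [h1, h2, ← card_union_of_disjoint]
  · apply card_le_card
    intro S
    simp only [mem_union, mem_image, mem_filter, mem_univ, true_and]
    rintro (⟨l, hl, rfl⟩ | hS)
    · exact ⟨l, by simp, by simp⟩
    · exact hS.1
  · rw [Finset.disjoint_left]
    intro S
    simp only [mem_image, mem_filter, mem_univ, true_and]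
    rintro ⟨l, hl, rfl⟩ ⟨-, v, hv, hvL⟩
    rw [mem_singleton] at hv
    exact hvL (hv ▸ hl)

lemma lower (h : Rooted G r p d) (hL : ∀ v, p v ∉ L) :
    bound (#L) (Fintype.card V - #L) ≤ numSubtrees G ∧
    (numSubtrees G ≤ bound (#L) (Fintype.card V - #L) →
      ∀ B : Finset V, (∀ x ∈ B, x ≠ r ∧ x ∉ L) → #(fam r p L B) = hh (#L) (#B)) := by
  classical
  have hrL : r ∈ Lᶜ := by simpa [h.pr] using hL r
  have hc : #(Lᶜ.erase r) + 1 = Fintype.card V - #L := by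
    rw [card_erase_add_one hrL, card_compl]
  rw [← hc, ← sum_hh]
  have ht := total (L := L) h
  have hle : ∀ B ∈ (Lᶜ.erase r).powerset, hh (#L) (#B) ≤ #(fam r p L B) :=
    fun B hB => fam_le h hL (mem_powerset.1 hB)
  have hs := sum_le_sum hle
  refine ⟨by omega, fun hN B hB => ?_⟩
  have := (sum_eq_sum_iff_of_le hle).1 (by omega) B (mem_powerset.2 (fun x hx => by simpa using hB x hx))
  exact this.symm

end

section
variable {M a b : ℕ}

/-- Parent map of `pathAB`. -/
def pp (M a b : ℕ) : Fin (M + 1) ⊕ (Fin a ⊕ Fin b) → Fin (M + 1) ⊕ (Fin a ⊕ Fin b)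
  | Sum.inl i => Sum.inl ⟨i - 1, by omega⟩
  | Sum.inr (Sum.inl _) => Sum.inl 0
  | Sum.inr (Sum.inr _) => Sum.inl (Fin.last M)

/-- Depth map of `pathAB`. -/
def dd (M a b : ℕ) : Fin (M + 1) ⊕ (Fin a ⊕ Fin b) → ℕ
  | Sum.inl i => i
  | Sum.inr (Sum.inl _) => 1
  | Sum.inr (Sum.inr _) => M + 1

lemma pathAB_rooted : Rooted (pathAB (M + 1) a b) (Sum.inl 0) (pp M a b) (dd M a b) := by
  refine ⟨rfl, rfl, ?_, ?_⟩
  · rintro (i | i | i) h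
    · have : i ≠ 0 := fun e => h (by rw [e])
      have : (i : ℕ) ≠ 0 := fun e => this (Fin.ext e)
      simp [pp, dd]
      omega
    · simp [pp, dd]
    · simp [pp, dd]
  · rintro (i | i | i) (j | j | j) <;> 
    simp only [pathAB, SimpleGraph.fromRel_adj, pp, ne_eq, Sum.inl.injEq, Sum.inr.injEq,
      reduceCtorEq, Fin.ext_iff, Fin.val_zero, Fin.val_last, not_false_eq_true, true_and,
      and_false, or_false, false_or, or_self] <;> omega

lemma pathAB_upper :
    numSubtrees (pathAB (M + 1) a b) ≤ (2 ^ a + 2 ^ b) * M + 2 ^ (a + b) + (a + b) +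
      M.choose 2 := by
  classical
  rw [pathAB_rooted.numSubtrees_eq]
  let seg : ℕ → ℕ → Finset (Fin a ⊕ Fin b) → Finset (Fin (M + 1) ⊕ (Fin a ⊕ Fin b)) :=
    fun lo hi X => (univ.filter (fun i : Fin (M + 1) => lo ≤ i.1 ∧ i.1 ≤ hi)).disjSum X
  let Q0 : Finset (Finset (Fin (M + 1) ⊕ (Fin a ⊕ Fin b))) :=
    univ.image (fun y : Fin a ⊕ Fin b => {Sum.inr y})
  let Q1 := univ.image (fun X : Finset (Fin a ⊕ Fin b) => seg 0 M X)
  let Q2 := (range M ×ˢ (univ : Finset (Finset (Fin b)))).image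
    (fun z => seg (z.1 + 1) M ((∅ : Finset (Fin a)).disjSum z.2))
  let Q3 := (range M ×ˢ (univ : Finset (Finset (Fin a)))).image
    (fun z => seg 0 z.1 (z.2.disjSum (∅ : Finset (Fin b))))
  let Q4 := (powersetCard 2 (range M)).image
    (fun P => (univ.filter (fun i : Fin (M + 1) =>
      ∃ u ∈ P, u < i.1 ∧ ∃ w ∈ P, i.1 ≤ w)).disjSum (∅ : Finset (Fin a ⊕ Fin b)))
  have c0 : #Q0 ≤ a + b := card_image_le.trans (by simp)
  have c1 : #Q1 ≤ 2 ^ (a + b) := card_image_le.trans (by simp)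
  have c2 : #Q2 ≤ M * 2 ^ b := card_image_le.trans (by simp)
  have c3 : #Q3 ≤ M * 2 ^ a := card_image_le.trans (by simp)
  have c4 : #Q4 ≤ M.choose 2 := card_image_le.trans (by simp)
  have hsub : (univ.filter (fun S => TC (Sum.inl 0) (pp M a b) S)) ⊆
      Q0 ∪ Q1 ∪ Q2 ∪ Q3 ∪ Q4 := by
    intro S hS
    rw [mem_filter] at hS
    obtain ⟨-, t, ht, hS⟩ := hS
    rcases t with i | y
    · -- top on the spine
      have hdown : ∀ n, ∀ j : Fin (M + 1), j.1 = n → Sum.inl j ∈ S →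
          i ≤ j ∧ ∀ l : Fin (M + 1), i ≤ l → l ≤ j → Sum.inl l ∈ S := by
        intro n
        induction n with
        | zero =>
          intro j hj hjS
          have : j = i := by
            by_contra hne
            exact (hS _ hjS (by simpa using hne)).1 (by simp [Fin.ext_iff, hj])
          subst this
          refine ⟨le_rfl, fun l h1 h2 => ?_⟩
          rw [le_antisymm h2 h1]
          exact hjS
        | succ n ih =>
          intro j hj hjS
          by_cases hji : j = i
          · subst hji
            refine ⟨le_rfl, fun l h1 h2 => ?_⟩
            rw [le_antisymm h2 h1]
            exact hjS
          · have h1 := (hS _ hjS (by simpa using hji)).2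
            simp only [pp] at h1
            obtain ⟨h2, h3⟩ := ih _ (by simp [hj]) h1
            rw [Fin.le_def] at h2
            simp only at h2
            refine ⟨by rw [Fin.le_def]; omega, fun l h4 h5 => ?_⟩
            by_cases hlj : l = j
            · rw [hlj]; exact hjS
            · apply h3 l h4
              rw [Fin.le_def] at h5 ⊢
              have : l.1 ≠ j.1 := fun e => hlj (Fin.ext e)
              simp only
              omega
      obtain ⟨q, hq, hmax⟩ := S.toLeft.exists_max_image id ⟨i, by simpa using ht⟩
      rw [mem_toLeft] at hq
      have hiq := (hdown _ q rfl hq).1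
      have hmem : ∀ j : Fin (M + 1), Sum.inl j ∈ S ↔ i ≤ j ∧ j ≤ q := by
        intro j
        constructor
        · intro h
          exact ⟨(hdown _ j rfl h).1, hmax j (by simpa using h)⟩
        · rintro ⟨h1, h2⟩
          exact (hdown _ q rfl hq).2 j h1 h2
      have hmem' : ∀ j : Fin (M + 1), Sum.inl j ∈ S ↔ i.1 ≤ j.1 ∧ j.1 ≤ q.1 := hmem
      have hA : ∀ y, Sum.inr (Sum.inl y) ∈ S → i = 0 := by
        intro y hy
        have := (hS _ hy (by simp)).2
        simp only [pp] at this
        have := ((hmem _).1 this).1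
        simpa using this
      have hB : ∀ y, Sum.inr (Sum.inr y) ∈ S → q = Fin.last M := by
        intro y hy
        have := (hS _ hy (by simp)).2
        simp only [pp] at this
        have := ((hmem _).1 this).2
        simpa using this
      have hqM : q.1 ≤ M := by omega
      rw [Fin.le_def] at hiq
      by_cases hi : i = 0
      · by_cases hqq : q = Fin.last M
        · have : S ∈ Q1 := by
            rw [mem_image]
            refine ⟨S.toRight, mem_univ _, ?_⟩
            ext (j | j)
            · simp [seg, hmem, hi, hqq, Fin.le_last]
              omega
            · simp [seg]
          simp only [mem_union]
          tauto
        · have : S ∈ Q3 := by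
            rw [mem_image]
            refine ⟨(q.1, S.toRight.toLeft), ?_, ?_⟩
            · have : q.1 ≠ M := fun e => hqq (Fin.ext e)
              simp
              omega
            · ext (j | j | j)
              · simp [seg, hmem, hi]
              · simp [seg]
              · have : Sum.inr (Sum.inr j) ∉ S := fun h => hqq (hB j h)
                simpa [seg] using this
          simp only [mem_union]
          tauto
      · have hi' : i.1 ≠ 0 := fun e => hi (Fin.ext e)
        by_cases hqq : q = Fin.last M
        · have : S ∈ Q2 := by
            rw [mem_image]
            refine ⟨(i.1 - 1, S.toRight.toRight), ?_, ?_⟩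
            · simp
              omega
            · ext (j | j | j)
              · simp only [seg, inl_mem_disjSum, mem_filter, mem_univ, true_and, hmem', hqq,
                  Fin.val_last]
                omega
              · have : Sum.inr (Sum.inl j) ∉ S := fun h => hi (hA j h)
                simpa [seg] using this
              · simp [seg]
          simp only [mem_union]
          tauto
        · have : S ∈ Q4 := by
            have : q.1 ≠ M := fun e => hqq (Fin.ext e)
            rw [mem_image]
            refine ⟨{i.1 - 1, q.1}, ?_, ?_⟩
            · rw [mem_powersetCard]
              refine ⟨?_, card_pair (by omega)⟩
              intro z hz
              simp at hz
              simp
              omega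
            · ext (j | j | j)
              · simp only [inl_mem_disjSum, mem_filter, mem_univ, true_and, hmem', mem_insert,
                  mem_singleton, exists_eq_or_imp, exists_eq_left]
                omega
              · have : Sum.inr (Sum.inl j) ∉ S := fun h => hi (hA j h)
                simpa using this
              · have : Sum.inr (Sum.inr j) ∉ S := fun h => hqq (hB j h)
                simpa using this
          simp only [mem_union]
          tauto
    · -- a single leaf
      have hno : ∀ n, ∀ j : Fin (M + 1), j.1 = n → Sum.inl j ∈ S → False := by
        intro n
        induction n with
        | zero =>
          intro j hj hjS
          exact (hS _ hjS (by simp)).1 (by simp [Fin.ext_iff, hj])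
        | succ n ih =>
          intro j hj hjS
          have := (hS _ hjS (by simp)).2
          exact ih _ (by simp [hj]) this
      have : S = {Sum.inr y} := by
        ext v
        rw [mem_singleton]
        constructor
        · intro hv
          by_contra hne
          have := (hS _ hv hne).2
          rcases v with j | j | j <;> exact hno _ _ rfl this
        · rintro rfl; exact ht
      have : S ∈ Q0 := by
        rw [mem_image]
        exact ⟨y, mem_univ _, this.symm⟩
      simp only [mem_union]
      tauto
  have := card_le_card hsub
  have u1 := card_union_le (Q0 ∪ Q1 ∪ Q2 ∪ Q3) Q4
  have u2 := card_union_le (Q0 ∪ Q1 ∪ Q2) Q3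
  have u3 := card_union_le (Q0 ∪ Q1) Q2
  have u4 := card_union_le Q0 Q1
  have e : (2 ^ a + 2 ^ b) * M = M * 2 ^ a + M * 2 ^ b := by ring
  omega

lemma pathAB_value (k M : ℕ) :
    numSubtrees (pathAB (M + 1) (k / 2) ((k + 1) / 2)) = bound k (M + 1) := by
  classical
  have hk : k / 2 + (k + 1) / 2 = k := by omega
  apply le_antisymm
  · have := pathAB_upper (M := M) (a := k / 2) (b := (k + 1) / 2)
    rw [hk] at this
    simpa [bound] using this
  · let L : Finset (Fin (M + 1) ⊕ (Fin (k / 2) ⊕ Fin ((k + 1) / 2))) :=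
      (∅ : Finset (Fin (M + 1))).disjSum univ
    have := (lower (L := L) pathAB_rooted (by rintro (i | i | i) <;> simp [L, pp])).1
    simpa [L, hk] using this

end

lemma iso_of_rooted {V W : Type*} {G : SimpleGraph V} {H : SimpleGraph W} {r : V} {p : V → V}
    {d : V → ℕ} {s : W} {q : W → W} {e : W → ℕ} (hG : Rooted G r p d) (hH : Rooted H s q e)
    (f : W ≃ V) (hf : ∀ w, f (q w) = p (f w)) (hs : f s = r) : Nonempty (G ≃g H) := by
  refine ⟨(RelIso.symm ⟨f, ?_⟩ : G ≃g H)⟩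
  intro u v
  rw [hG.adj, hH.adj, ← hs, ← hf, ← hf]
  simp

lemma pathAB_swap (m a b : ℕ) : Nonempty (pathAB m a b ≃g pathAB m b a) := by
  refine ⟨⟨Equiv.sumCongr Fin.revPerm (Equiv.sumComm _ _), ?_⟩⟩
  rintro (i | i | i) (j | j | j) <;>
    simp [pathAB, SimpleGraph.fromRel_adj, Fin.val_rev] <;> omega

section
variable {V : Type*} [Fintype V] {G : SimpleGraph V} {r : V} {p : V → V} {d : V → ℕ}
  {L : Finset V}

lemma child_unique (h : Rooted G r p d) (hL : ∀ v, p v ∉ L)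
    (hr : ∀ y z, y ∉ L → z ∉ L → y ≠ r → z ≠ r → p y = r → p z = r → y = z)
    (hfam : ∀ B : Finset V, (∀ x ∈ B, x ≠ r ∧ x ∉ L) → #(fam r p L B) = hh (#L) (#B))
    {y z : V} (hy : y ∉ L) (hz : z ∉ L) (hyr : y ≠ r) (hzr : z ≠ r) (hyz : p y = p z) :
    y = z := by
  classical
  by_contra hne
  have hxr : p y ≠ r := fun e => hne (hr y z hy hz hyr hzr e (hyz ▸ e))
  obtain ⟨x, hx⟩ : ∃ x, x = p y := ⟨_, rfl⟩
  have hxL : x ∉ L := hx ▸ hL y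
  rw [← hx] at hxr
  have hzx : p z = x := by rw [← hyz, hx]
  have dx := h.dp x hxr
  have dy := h.dp y hyr
  have dz := h.dp z hzr
  rw [← hx] at dy
  rw [hzx] at dz
  have n1 : y ≠ x := by rintro rfl; omega
  have n2 : z ≠ x := by rintro rfl; omega
  have n3 : p x ≠ x := by intro e; rw [e] at dx; omega
  have hmem : ({x} : Finset V) ∈ fam r p L (bd r p L {x}) := by
    simp only [fam, mem_filter, mem_univ, true_and]
    exact ⟨⟨x, by simp, by simp⟩, ⟨x, by simp, hxL⟩, trivial⟩
  have hsub : ({x, y, z} : Finset V) ⊆ bd r p L {x} := by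
    intro u hu
    simp only [mem_insert, mem_singleton] at hu
    simp only [bd, mem_filter, mem_erase, mem_compl, mem_singleton]
    rcases hu with rfl | rfl | rfl
    · exact ⟨⟨hxr, hxL⟩, by simp [n3]⟩
    · exact ⟨⟨hyr, hy⟩, by simp [n1, ← hx]⟩
    · exact ⟨⟨hzr, hz⟩, by simp [n2, hzx]⟩
  have hcard : 3 ≤ #(bd r p L {x}) := by
    have h3 : #({x, y, z} : Finset V) = 3 := card_eq_three.2 ⟨x, y, z, n1.symm, n2.symm, hne, rfl⟩
    rw [← h3]
    exact card_le_card hsub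
  have := hfam (bd r p L {x}) (by
    intro u hu
    simp only [bd, mem_filter, mem_erase, mem_compl] at hu
    exact hu.1)
  obtain ⟨j, hj⟩ : ∃ j, #(bd r p L {x}) = j + 1 + 1 + 1 := ⟨#(bd r p L {x}) - 3, by omega⟩
  rw [hj] at this
  simp only [hh, card_eq_zero] at this
  rw [this] at hmem
  simp at hmem

lemma no_inner_leaf (h : Rooted G r p d) (hL : ∀ v, p v ∉ L)
    (hfam : ∀ B : Finset V, (∀ x ∈ B, x ≠ r ∧ x ∉ L) → #(fam r p L B) = hh (#L) (#B))
    {x y l : V} (hxr : x ≠ r) (hy : y ∉ L) (hyr : y ≠ r) (hyx : p y = x) (hl : l ∈ L)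
    (hlx : p l = x) : False := by
  classical
  have hxL : x ∉ L := hyx ▸ hL y
  have dy := h.dp y hyr
  rw [hyx] at dy
  have n1 : x ≠ y := by rintro rfl; omega
  have hd : Desc p x y := (Desc.step n1.symm).2 (hyx ▸ Desc.refl _)
  have hnd : ¬ Desc p y x := fun e => n1 (h.desc_antisymm hxr hyr hd e).symm
  have m1 := fam_two_desc h hL hxr hxL hyr hy n1 hd (B := {x, y}) (by simp) (empty_subset L)
    (by simp)
  have m2 := fam_two_desc h hL hxr hxL hyr hy n1 hd (B := {x, y}) (X := {l}) (by simp)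
    (by simpa using hl) (by
      intro u hu
      rw [mem_singleton] at hu
      rw [hu, hlx]
      exact ⟨Desc.refl _, hnd⟩)
  have hc := hfam {x, y} (by
    intro u hu
    simp only [mem_insert, mem_singleton] at hu
    rcases hu with rfl | rfl
    · exact ⟨hxr, hxL⟩
    · exact ⟨hyr, hy⟩)
  rw [card_pair n1] at hc
  simp only [hh] at hc
  have e := card_le_one.1 hc.le _ m1 _ m2
  have := mk_inj (empty_subset L) (by simpa using hl) e
  exact absurd this.symm (singleton_ne_empty l)

open Classical in
lemma leaf_balance (h : Rooted G r p d) (hL : ∀ v, p v ∉ L)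
    (hfam : ∀ B : Finset V, (∀ x ∈ B, x ≠ r ∧ x ∉ L) → #(fam r p L B) = hh (#L) (#B))
    {x : V} (hxr : x ≠ r) (hx : x ∉ L) :
    #{l ∈ L | ¬ Desc p x l} = #L / 2 ∨ #{l ∈ L | ¬ Desc p x l} = (#L + 1) / 2 := by
  have h1 := fam_one h hL hxr hx
  rw [hfam {x} (by simpa using ⟨hxr, hx⟩), card_singleton] at h1
  simp only [hh] at h1
  have h2 := card_filter_add_card_filter_not (s := L) (Desc p x)
  have h3 := (two_pow_bal h2).2 h1
  omega

lemma spine (h : Rooted G r p d) (hL : ∀ v, p v ∉ L) {M : ℕ} (hM : Fintype.card V = #L + (M + 1))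
    (hch : ∀ y z, y ∉ L → z ∉ L → y ≠ r → z ≠ r → p y = p z → y = z) :
    ∃ g : Fin (M + 1) → V, (∀ i, g i ∉ L) ∧ (∀ i, d (g i) = i) ∧
      (∀ v, v ∉ L → ∃ i, g i = v) := by
  classical
  have hrL : r ∉ L := by simpa [h.pr] using hL r
  have hd0 : ∀ v, d v = 0 → v = r := by
    intro v hv
    by_contra hne
    have := h.dp v hne
    omega
  have hinj : ∀ n u v, u ∉ L → v ∉ L → d u = n → d v = n → u = v := by
    intro n
    induction n with
    | zero =>
      intro u v _ _ hu hv
      rw [hd0 u hu, hd0 v hv]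
    | succ n ih =>
      intro u v hu hv du dv
      have ur : u ≠ r := by rintro rfl; rw [h.dr] at du; omega
      have vr : v ≠ r := by rintro rfl; rw [h.dr] at dv; omega
      have eu := h.dp u ur
      have ev := h.dp v vr
      exact hch u v hu hv ur vr (ih _ _ (hL u) (hL v) (by omega) (by omega))
  have hdown : ∀ n, ∀ v, v ∉ L → d v = n → ∀ i ≤ n, ∃ u, u ∉ L ∧ d u = i := by
    intro n
    induction n with
    | zero =>
      intro v hv dv i hi
      exact ⟨v, hv, by omega⟩
    | succ n ih =>
      intro v hv dv i hi
      by_cases hin : i = n + 1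
      · exact ⟨v, hv, by omega⟩
      · have vr : v ≠ r := by rintro rfl; rw [h.dr] at dv; omega
        have ev := h.dp v vr
        exact ih (p v) (hL v) (by omega) i (by omega)
  have hcard : #Lᶜ = M + 1 := by rw [card_compl]; omega
  have himg : #(Lᶜ.image d) = M + 1 := by
    rw [card_image_of_injOn, hcard]
    intro u hu v hv e
    exact hinj _ u v (by simpa using hu) (by simpa using hv) e rfl
  have hlt : ∀ v, v ∉ L → d v < M + 1 := by
    intro v hv
    by_contra hge
    have : range (M + 2) ⊆ Lᶜ.image d := by
      intro i hi
      rw [mem_range] at hi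
      obtain ⟨u, hu, e⟩ := hdown _ v hv rfl i (by omega)
      exact mem_image.2 ⟨u, by simpa using hu, e⟩
    have := card_le_card this
    rw [himg, card_range] at this
    omega
  have heq : Lᶜ.image d = range (M + 1) := by
    apply eq_of_subset_of_card_le
    · intro i hi
      obtain ⟨u, hu, rfl⟩ := mem_image.1 hi
      exact mem_range.2 (hlt u (by simpa using hu))
    · rw [himg, card_range]
  have hex : ∀ i : Fin (M + 1), ∃ u, u ∉ L ∧ d u = i := by
    intro i
    have : i.1 ∈ Lᶜ.image d := by rw [heq, mem_range]; exact i.2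
    obtain ⟨u, hu, e⟩ := mem_image.1 this
    exact ⟨u, by simpa using hu, e⟩
  choose g hg using hex
  exact ⟨g, fun i => (hg i).1, fun i => (hg i).2, fun v hv =>
    ⟨⟨d v, hlt v hv⟩, hinj _ _ _ (hg _).1 hv (hg _).2 rfl⟩⟩

lemma build_iso (h : Rooted G r p d) (hL : ∀ v, p v ∉ L) {M : ℕ} {g : Fin (M + 1) → V}
    (g1 : ∀ i, g i ∉ L) (g2 : ∀ i, d (g i) = i) (g3 : ∀ v, v ∉ L → ∃ i, g i = v)
    {A B : Finset V} (hAB : ∀ v, v ∈ L ↔ v ∈ A ∨ v ∈ B) (hdis : Disjoint A B)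
    (hA : ∀ l ∈ A, p l = g 0) (hB : ∀ l ∈ B, p l = g (Fin.last M)) :
    Nonempty (G ≃g pathAB (M + 1) (#A) (#B)) := by
  classical
  have hrL : r ∉ L := by simpa [h.pr] using hL r
  have ginj : ∀ i j, d (g i) = d (g j) → i = j := by
    intro i j e
    rw [g2, g2] at e
    exact Fin.ext e
  have g0 : g 0 = r := by
    obtain ⟨i, hi⟩ := g3 r hrL
    have := g2 i
    rw [hi, h.dr] at this
    have : i = 0 := Fin.ext this.symm
    rw [← this, hi]
  let f : Fin (M + 1) ⊕ (Fin #A ⊕ Fin #B) → V :=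
    Sum.elim g (Sum.elim (fun i => (A.equivFin.symm i).1) (fun i => (B.equivFin.symm i).1))
  have fA : ∀ i, (A.equivFin.symm i).1 ∈ A := fun i => (A.equivFin.symm i).2
  have fB : ∀ i, (B.equivFin.symm i).1 ∈ B := fun i => (B.equivFin.symm i).2
  have hbij : Function.Bijective f := by
    constructor
    · apply Function.Injective.sumElim
      · intro i j e
        exact ginj i j (by rw [e])
      · apply Function.Injective.sumElim
        · exact Subtype.val_injective.comp A.equivFin.symm.injective
        · exact Subtype.val_injective.comp B.equivFin.symm.injective
        · intro i j e
          exact Finset.disjoint_left.1 hdis (fA i) (e ▸ fB j)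
      · rintro i (j | j) e
        · exact g1 i ((hAB _).2 (Or.inl (e ▸ fA j)))
        · exact g1 i ((hAB _).2 (Or.inr (e ▸ fB j)))
    · intro v
      by_cases hv : v ∈ L
      · rcases (hAB v).1 hv with hv | hv
        · exact ⟨Sum.inr (Sum.inl (A.equivFin ⟨v, hv⟩)), by simp [f]⟩
        · exact ⟨Sum.inr (Sum.inr (B.equivFin ⟨v, hv⟩)), by simp [f]⟩
      · obtain ⟨i, hi⟩ := g3 v hv
        exact ⟨Sum.inl i, hi⟩
  refine iso_of_rooted h pathAB_rooted (Equiv.ofBijective f hbij) ?_ g0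
  rintro (i | i | i)
  · change g ⟨i - 1, _⟩ = p (g i)
    by_cases hi : i = 0
    · subst hi
      rw [g0, h.pr, ← g0]
      rfl
    · have hi' : i.1 ≠ 0 := fun e => hi (Fin.ext e)
      have hne : g i ≠ r := by
        intro e
        have := g2 i
        rw [e, h.dr] at this
        exact hi' this.symm
      obtain ⟨j, hj⟩ := g3 _ (hL (g i))
      rw [← hj]
      congr 1
      have e := h.dp _ hne
      rw [← hj, g2, g2] at e
      apply Fin.ext
      simp only
      omega
  · exact (hA _ (fA i)).symm
  · exact (hB _ (fB i)).symm

lemma unique_iso (h : Rooted G r p d) (hL : ∀ v, p v ∉ L) {M : ℕ}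
    (hM : Fintype.card V = #L + (M + 1))
    (hr : ∀ y z, y ∉ L → z ∉ L → y ≠ r → z ≠ r → p y = r → p z = r → y = z)
    (hfam : ∀ B : Finset V, (∀ x ∈ B, x ≠ r ∧ x ∉ L) → #(fam r p L B) = hh (#L) (#B)) :
    Nonempty (G ≃g pathAB (M + 1) (#L / 2) ((#L + 1) / 2)) := by
  classical
  have hrL : r ∉ L := by simpa [h.pr] using hL r
  have hch := fun y z h1 h2 h3 h4 h5 => child_unique h hL hr hfam (y := y) (z := z) h1 h2 h3 h4 h5
  obtain ⟨g, g1, g2, g3⟩ := spine h hL hM hch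
  have g0 : g 0 = r := by
    obtain ⟨i, hi⟩ := g3 r hrL
    have := g2 i
    rw [hi, h.dr] at this
    have : i = 0 := Fin.ext this.symm
    rw [← this, hi]
  have hgr : ∀ i : Fin (M + 1), i.1 ≠ 0 → g i ≠ r := by
    intro i hi e
    have := g2 i
    rw [e, h.dr] at this
    exact hi this.symm
  have ends : ∀ l ∈ L, p l = g 0 ∨ p l = g (Fin.last M) := by
    intro l hl
    obtain ⟨j, hj⟩ := g3 _ (hL l)
    by_contra! hcon
    have hj0 : j.1 ≠ 0 := by
      intro e
      exact hcon.1 (by rw [← hj, show j = 0 from Fin.ext e])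
    have hjM : j.1 ≠ M := by
      intro e
      exact hcon.2 (by rw [← hj, show j = Fin.last M from Fin.ext e])
    have hjlt : j.1 + 1 < M + 1 := by omega
    have hyr := hgr ⟨j.1 + 1, hjlt⟩ (by simp)
    refine no_inner_leaf h hL hfam (x := g j) (y := g ⟨j.1 + 1, hjlt⟩) (l := l) (hgr j hj0)
      (g1 _) hyr ?_ hl hj.symm
    obtain ⟨i, hi⟩ := g3 _ (hL (g ⟨j.1 + 1, hjlt⟩))
    have e := h.dp _ hyr
    rw [← hi, g2, g2] at e
    rw [← hi]
    congr 1
    apply Fin.ext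
    simp only at e
    omega
  obtain ⟨A, hAL, hA, hB, hcA⟩ : ∃ A ⊆ L, (∀ l ∈ A, p l = g 0) ∧
      (∀ l ∈ L \ A, p l = g (Fin.last M)) ∧ (#A = #L / 2 ∨ #A = (#L + 1) / 2) := by
    rcases Nat.eq_zero_or_pos M with hM0 | hM0
    · subst hM0
      obtain ⟨A, hA, hc⟩ := exists_subset_card_eq (s := L) (n := #L / 2) (by omega)
      have hl0 : g (Fin.last 0) = g 0 := rfl
      rw [hl0] at ends
      rw [hl0]
      simp only [or_self] at ends
      exact ⟨A, hA, fun l hl => ends l (hA hl), fun l hl => ends l (mem_sdiff.1 hl).1, Or.inl hc⟩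
    · have hne : g (Fin.last M) ≠ r := hgr _ (by simp; omega)
      have hst : ∀ l ∈ L, (Desc p (g (Fin.last M)) l ↔ Desc p (g (Fin.last M)) (p l)) :=
        fun l hl => Desc.step (fun e => g1 _ (e ▸ hl))
      refine ⟨L.filter (fun l => ¬ Desc p (g (Fin.last M)) l), filter_subset _ _, ?_, ?_,
        leaf_balance h hL hfam hne (g1 _)⟩
      · intro l hl
        rw [mem_filter] at hl
        rw [hst l hl.1] at hl
        rcases ends l hl.1 with e | e
        · exact e
        · rw [e] at hl
          exact absurd (Desc.refl _) hl.2
      · intro l hl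
        simp only [mem_sdiff, mem_filter, not_and, not_not] at hl
        rcases ends l hl.1 with e | e
        · have := (hst l hl.1).1 (hl.2 hl.1)
          rw [e, g0] at this
          exact absurd this (h.not_desc_root hne)
        · exact e
  have hiso := build_iso h hL g1 g2 g3 (A := A) (B := L \ A) (by
    intro v
    rw [mem_sdiff]
    have := @hAL v
    tauto) disjoint_sdiff hA hB
  have hcB : #(L \ A) = #L - #A := card_sdiff_of_subset hAL
  rcases hcA with hc | hc
  · have e : #(L \ A) = (#L + 1) / 2 := by omega
    rw [hc, e] at hiso
    exact hiso
  · have e : #(L \ A) = #L / 2 := by omega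
    rw [hc, e] at hiso
    obtain ⟨i1⟩ := hiso
    obtain ⟨i2⟩ := pathAB_swap (M + 1) ((#L + 1) / 2) (#L / 2)
    exact ⟨i1.trans i2⟩

lemma parent_notLeaf (h : Rooted G r p d) (hLd : ∀ v, v ∈ L ↔ (G.neighborSet v).ncard = 1)
    (hr : r ∉ L) (v : V) : p v ∉ L := by
  by_cases hv : v = r
  · rw [hv, h.pr]; exact hr
  by_cases hp : p v = r
  · rw [hp]; exact hr
  rw [hLd, Set.ncard_eq_one]
  rintro ⟨u, hu⟩
  have a1 : v ∈ G.neighborSet (p v) := (h.adj _ _).2 (Or.inr ⟨hv, rfl⟩)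
  have a2 : p (p v) ∈ G.neighborSet (p v) := (h.adj _ _).2 (Or.inl ⟨hp, rfl⟩)
  rw [hu, Set.mem_singleton_iff] at a1 a2
  have e1 := h.dp v hv
  have e2 := h.dp _ hp
  rw [a2, ← a1] at e2
  omega

end

lemma main_aux {V : Type} [Fintype V] (G : SimpleGraph V) (hG : G.IsTree) (k M : ℕ)
    (hn : Fintype.card V = k + (M + 1)) (hk : {v : V | (G.neighborSet v).ncard = 1}.ncard = k) :
    bound k (M + 1) ≤ numSubtrees G ∧
      (numSubtrees G ≤ bound k (M + 1) →
        Nonempty (G ≃g pathAB (M + 1) (k / 2) ((k + 1) / 2))) := by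
  classical
  obtain ⟨L, hLd⟩ : ∃ L : Finset V, ∀ v, v ∈ L ↔ (G.neighborSet v).ncard = 1 :=
    ⟨univ.filter (fun v => (G.neighborSet v).ncard = 1), by simp⟩
  have hLk : #L = k := by
    rw [← hk, ← Set.ncard_coe_finset]
    congr 1
    ext v
    simp [hLd]
  subst hLk
  have hne : (Lᶜ).Nonempty := by
    rw [← card_pos, card_compl]
    omega
  obtain ⟨r0, hr0⟩ := hne
  obtain ⟨p0, d0, h0⟩ := exists_rooted G hG r0
  obtain ⟨r, hr, hmax⟩ := Lᶜ.exists_max_image d0 ⟨r0, hr0⟩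
  have hnb : ∀ u, u ∉ L → G.Adj u r → u = p0 r := by
    intro u hu hadj
    rcases (h0.adj _ _).1 hadj with ⟨h1, h2⟩ | ⟨h1, h2⟩
    · have := h0.dp u h1
      have := hmax u (by simpa using hu)
      rw [h2] at *
      omega
    · exact h2.symm
  obtain ⟨p, d, h⟩ := exists_rooted G hG r
  have hL := parent_notLeaf h hLd (by simpa using hr)
  have hlow := lower h hL
  rw [show Fintype.card V - #L = M + 1 by omega] at hlow
  refine ⟨hlow.1, fun hle => ?_⟩
  refine unique_iso h hL hn ?_ (hlow.2 hle)
  intro y z hy hz hyr hzr ey ez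
  rw [hnb y hy ((h.adj _ _).2 (Or.inl ⟨hyr, ey⟩)), hnb z hz ((h.adj _ _).2 (Or.inl ⟨hzr, ez⟩))]

end SubtreeMin


/-- Among `n`-vertex trees with exactly `k` leaves (`2 ≤ k ≤ n-1`), the tree
`P_{n-k}(⌊k/2⌋, ⌈k/2⌉)` uniquely minimizes the number of subtrees, achieving the stated
value. -/
theorem pathAB_min_numSubtrees (n k : ℕ) (hk2 : 2 ≤ k) (hkn : k ≤ n - 1) :
    numSubtrees (pathAB (n - k) (k / 2) ((k + 1) / 2)) =
      (2 ^ (k / 2) + 2 ^ ((k + 1) / 2)) * (n - k - 1) + 2 ^ k + k + (n - k - 1).choose 2 ∧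
    ∀ (V : Type) [Fintype V] (G : SimpleGraph V), G.IsTree →
      Fintype.card V = n → {v : V | (G.neighborSet v).ncard = 1}.ncard = k →
      (numSubtrees (pathAB (n - k) (k / 2) ((k + 1) / 2)) ≤ numSubtrees G ∧
        (numSubtrees G = numSubtrees (pathAB (n - k) (k / 2) ((k + 1) / 2)) →
          Nonempty (G ≃g pathAB (n - k) (k / 2) ((k + 1) / 2)))) := by
  obtain ⟨M, hM⟩ : ∃ M, n - k = M + 1 := ⟨n - k - 1, by omega⟩
  rw [hM, SubtreeMin.pathAB_value]
  refine ⟨by simp [SubtreeMin.bound], ?_⟩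
  intro V _ G hG hn hk
  have := SubtreeMin.main_aux G hG k M (by omega) hk
  exact ⟨this.1, fun e => this.2 e.le⟩
end

section
/- Among all n-vertex trees having a (p,q)-bipartition (q ≥ p ≥ 1, p + q = n), the double star D(p,q) uniquely maximizes the number of subtrees. -/
open SimpleGraph

/-- The double star `D(p,q)` on `p + q` vertices: the center `Sum.inl 0` is adjacent to the
`p - 1` leaves `Sum.inl i` (`i ≠ 0`) and to the center `Sum.inr 0`, which is adjacent to
the `q - 1` leaves `Sum.inr j` (`j ≠ 0`). -/
def doubleStar (p q : ℕ) : SimpleGraph (Fin p ⊕ Fin q) :=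
  SimpleGraph.fromRel (fun x y =>
    match x, y with
    | Sum.inl i, Sum.inl _ => (i : ℕ) = 0
    | Sum.inr i, Sum.inr _ => (i : ℕ) = 0
    | Sum.inl i, Sum.inr j => (i : ℕ) = 0 ∧ (j : ℕ) = 0
    | Sum.inr _, Sum.inl _ => False)

open Classical in
/-- Cut-connectedness of a finite vertex set. -/
def CutConn {V : Type*} (G : SimpleGraph V) (C : Finset V) : Prop :=
  ∀ B ⊆ C, B.Nonempty → B ≠ C → ∃ b ∈ B, ∃ c ∈ C, c ∉ B ∧ G.Adj b c

section helpers
open Classical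

variable {V : Type*} {G : SimpleGraph V}

lemma cutConn_of_connected {C : Finset V} (h : (G.induce (C : Set V)).Connected) :
    CutConn G C := by
  intro B hB hne hBC
  obtain ⟨b, hb⟩ := hne
  obtain ⟨c, hc, hcB⟩ : ∃ c ∈ C, c ∉ B := by
    by_contra! hh
    exact hBC (Finset.Subset.antisymm hB hh)
  obtain ⟨w⟩ := h.preconnected ⟨b, hB hb⟩ ⟨c, hc⟩
  obtain ⟨d, -, h1, h2⟩ := w.exists_boundary_dart {x | x.1 ∈ B} hb hcB
  exact ⟨d.fst.1, h1, d.snd.1, d.snd.2, h2, d.adj⟩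

lemma connected_of_cutConn {C : Finset V} (hne : C.Nonempty) (h : CutConn G C) :
    (G.induce (C : Set V)).Connected := by
  obtain ⟨u, hu⟩ := hne
  have key : ∀ v (hv : v ∈ C), (G.induce (C : Set V)).Reachable ⟨u, hu⟩ ⟨v, hv⟩ := by
    by_contra! hh
    obtain ⟨v, hv, hr⟩ := hh
    let B : Finset V := C.filter (fun v => ∃ hv : v ∈ C, (G.induce (C : Set V)).Reachable ⟨u, hu⟩ ⟨v, hv⟩)
    obtain ⟨b, hb, c, hc, hcB, hadj⟩ := h B (Finset.filter_subset _ _)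
      ⟨u, by simp only [B, Finset.mem_filter]; exact ⟨hu, hu, Reachable.refl _⟩⟩
      (by
        intro he
        have : v ∈ B := he ▸ hv
        simp only [B, Finset.mem_filter] at this
        exact hr this.2.2)
    simp only [B, Finset.mem_filter] at hb hcB
    obtain ⟨_, hb1, hb2⟩ := hb
    apply hcB
    refine ⟨hc, hc, hb2.trans (Adj.reachable ?_)⟩
    exact hadj
  have : Nonempty (C : Set V) := ⟨⟨u, hu⟩⟩
  refine ⟨fun x y => (key x.1 x.2).symm.trans (key y.1 y.2)⟩

lemma cutConn_singleton (u : V) : CutConn G {u} := by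
  intro B hB hne h
  rcases Finset.subset_singleton_iff.1 hB with h1 | h1
  · simp [h1] at hne
  · exact absurd h1 h

lemma cutConn_insert {B : Finset V} {x w : V} (hB : CutConn G B) (hx : x ∈ B)
    (hadj : G.Adj x w) : CutConn G (insert w B) := by
  have h1 := connected_of_cutConn ⟨x, hx⟩ hB
  by_cases hw : w ∈ B
  · rwa [Finset.insert_eq_of_mem hw]
  intro D hD hne hDB
  by_cases hDBne : D ∩ B = ∅
  · have hDw : ∀ d ∈ D, d = w := by
      intro d hd
      have := hD hd
      rcases Finset.mem_insert.1 this with h | h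
      · exact h
      · have : d ∈ D ∩ B := Finset.mem_inter.2 ⟨hd, h⟩
        simp [hDBne] at this
    obtain ⟨d, hd⟩ := hne
    have := hDw d hd
    subst this
    refine ⟨d, hd, x, by simp [hx], ?_, hadj.symm⟩
    intro hxD
    exact hw ((hDw x hxD) ▸ hx)
  · by_cases hDB2 : D ∩ B = B
    · have hsub : B ⊆ D := Finset.inter_eq_right.1 hDB2
      refine ⟨x, hsub hx, w, by simp, ?_, hadj⟩
      intro hwD
      exact hDB (Finset.Subset.antisymm hD (Finset.insert_subset hwD hsub))
    · obtain ⟨b, hb, c, hc, hcB, ha⟩ := hB (D ∩ B) Finset.inter_subset_right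
        (Finset.nonempty_iff_ne_empty.2 hDBne) hDB2
      refine ⟨b, (Finset.mem_inter.1 hb).1, c, by simp [hc], ?_, ha⟩
      intro hcD
      exact hcB (Finset.mem_inter.2 ⟨hcD, hc⟩)

lemma unique_nbr (hG : G.IsAcyclic) {B : Finset V} {x y w : V} (hB : CutConn G B)
    (hx : x ∈ B) (hy : y ∈ B) (hw : w ∉ B) (hxw : G.Adj x w) (hyw : G.Adj y w) : y = x := by
  have h1 := connected_of_cutConn ⟨x, hx⟩ hB
  obtain ⟨p, hp⟩ := h1.exists_isPath ⟨x, hx⟩ ⟨y, hy⟩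
  let f := (Embedding.induce (G := G) (B : Set V))
  have hq : (p.map f.toHom).IsPath := hp.map f.injective
  have hws : w ∉ (p.map f.toHom).support := by
    rw [Walk.support_map]
    intro h
    obtain ⟨z, _, hz⟩ := List.mem_map.1 h
    apply hw
    rw [← hz]
    exact z.2
  obtain ⟨q, hq, hws, hql⟩ : ∃ q : G.Walk x y, q.IsPath ∧ w ∉ q.support ∧ q.length = p.length :=
    ⟨p.map f.toHom, hq, hws, Walk.length_map _ _⟩
  have hP : (Walk.cons hxw.symm q).IsPath := by
    rw [Walk.cons_isPath_iff]
    exact ⟨hq, hws⟩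
  have hP2 : (Walk.cons hyw.symm Walk.nil : G.Walk w y).IsPath := by
    rw [Walk.cons_isPath_iff]
    refine ⟨Walk.IsPath.nil, ?_⟩
    simp only [Walk.support_nil, List.mem_singleton]
    exact hyw.ne'
  have he := (hG.subsingleton_path w y).elim ⟨_, hP⟩ ⟨_, hP2⟩
  have hl := congrArg (fun q : G.Path w y => q.1.length) he
  simp only [Walk.length_cons, Walk.length_nil] at hl
  have : p.length = 0 := by omega
  have := Walk.eq_of_length_eq_zero this
  exact (congrArg Subtype.val this).symm

/-- Leaf decomposition. -/
lemma exists_leaf (hG : G.IsAcyclic) {A : Finset V} {u : V} (hA : CutConn G A) (hu : u ∈ A)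
    (hne : A ≠ {u}) : ∃ B x w, CutConn G B ∧ u ∈ B ∧ x ∈ B ∧ w ∉ B ∧ A = insert w B ∧ G.Adj x w ∧
      ∀ y ∈ B, G.Adj y w → y = x := by
  let X := A.powerset.filter (fun B => u ∈ B ∧ CutConn G B ∧ B ≠ A)
  have hX : X.Nonempty := ⟨{u}, by
    simp only [X, Finset.mem_filter, Finset.mem_powerset, Finset.singleton_subset_iff]
    exact ⟨hu, by simp, cutConn_singleton u, hne.symm⟩⟩
  obtain ⟨B, hB, hmax⟩ := Finset.exists_max_image X Finset.card hX
  simp only [X, Finset.mem_filter, Finset.mem_powerset] at hB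
  obtain ⟨hBA, huB, hBc, hBne⟩ := hB
  obtain ⟨x, hx, w, hw, hwB, hadj⟩ := hA B hBA ⟨u, huB⟩ hBne
  refine ⟨B, x, w, hBc, huB, hx, hwB, ?_, hadj, ?_⟩
  · by_contra hne2
    have := hmax (insert w B) (by
      simp only [X, Finset.mem_filter, Finset.mem_powerset]
      exact ⟨Finset.insert_subset hw hBA, by simp [huB], cutConn_insert hBc hx hadj,
        fun h => hne2 h.symm⟩)
    rw [Finset.card_insert_of_notMem hwB] at this
    omega
  · intro y hy hyw
    exact unique_nbr hG hBc hx hy hwB hadj hyw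

/-- Removing a leaf keeps cut-connectedness. -/
lemma cutConn_erase_leaf {B C : Finset V} {x w : V}
    (hu : ∀ y ∈ B, G.Adj y w → y = x) (hC : CutConn G C) (hCB : C ⊆ insert w B) :
    CutConn G (C.erase w) := by
  have huC : ∀ y ∈ C, G.Adj y w → y = x := by
    intro y hy h
    rcases Finset.mem_insert.1 (hCB hy) with h1 | h1
    · subst h1; exact absurd h (G.loopless.irrefl _)
    · exact hu y h1 h
  intro D hD hne hDne
  have hDC : D ⊆ C := hD.trans (Finset.erase_subset _ _)
  have hwD : w ∉ D := fun h => by simpa using hD h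
  by_cases hwC : w ∈ C
  swap
  · rw [Finset.erase_eq_of_notMem hwC] at *
    exact hC D hD hne hDne
  by_cases hxD : x ∈ D
  · obtain ⟨b, hb, c, hc, hcD, ha⟩ := hC (insert w D) (Finset.insert_subset hwC hDC) (by simp) (by
      intro h
      apply hDne
      rw [← h, Finset.erase_insert hwD])
    rw [Finset.mem_insert, not_or] at hcD
    rcases Finset.mem_insert.1 hb with h | h
    · subst h
      have := huC c hc ha.symm
      exact absurd (this ▸ hxD) hcD.2
    · exact ⟨b, h, c, Finset.mem_erase.2 ⟨hcD.1, hc⟩, hcD.2, ha⟩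
  · obtain ⟨b, hb, c, hc, hcD, ha⟩ := hC D hDC hne (fun h => hwD (h ▸ hwC))
    refine ⟨b, hb, c, Finset.mem_erase.2 ⟨?_, hc⟩, hcD, ha⟩
    rintro rfl
    exact hxD (huC b (hDC hb) ha ▸ hb)

lemma mem_of_leaf {B C : Finset V} {x w : V}
    (hu : ∀ y ∈ B, G.Adj y w → y = x) (hC : CutConn G C) (hCB : C ⊆ insert w B)
    (hw : w ∈ C) (hne : C ≠ {w}) : x ∈ C.erase w := by
  obtain ⟨b, hb, c, hc, hcD, ha⟩ := hC {w} (by simpa using hw) (by simp) hne.symm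
  simp only [Finset.mem_singleton] at hb hcD
  subst hb
  have hcB := (Finset.mem_insert.1 (hCB hc)).resolve_left hcD
  have := hu c hcB ha.symm
  subst this
  exact Finset.mem_erase.2 ⟨hcD, hc⟩

/-- number of connected subsets of `B` containing all of `U`. -/
noncomputable def cntU (G : SimpleGraph V) (B U : Finset V) : ℕ :=
  (B.powerset.filter (fun C => U ⊆ C ∧ CutConn G C)).card

/-- number of nonempty connected subsets of `B`. -/
noncomputable def cntF (G : SimpleGraph V) (B : Finset V) : ℕ :=
  (B.powerset.filter (fun C => C.Nonempty ∧ CutConn G C)).card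

lemma cntU_step {B : Finset V} {u x w : V} (hu : u ∈ B) (hw : w ∉ B)
    (hx : ∀ y ∈ B, G.Adj y w → y = x) :
    cntU G (insert w B) {u} ≤ cntU G B {u} + cntU G B {u, x} := by
  have huw : u ≠ w := fun h => hw (h ▸ hu)
  have : (insert w B).powerset.filter (fun C => {u} ⊆ C ∧ CutConn G C) ⊆
      (B.powerset.filter (fun C => {u} ⊆ C ∧ CutConn G C)) ∪
      (B.powerset.filter (fun C => {u, x} ⊆ C ∧ CutConn G C)).image (fun C => insert w C) := by
    intro C hC
    simp only [Finset.mem_filter, Finset.mem_powerset, Finset.singleton_subset_iff] at hC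
    obtain ⟨h1, h2, h3⟩ := hC
    by_cases hwC : w ∈ C
    · apply Finset.mem_union_right
      refine Finset.mem_image.2 ⟨C.erase w, ?_, Finset.insert_erase hwC⟩
      have hne : C ≠ {w} := by
        rintro rfl
        exact huw (Finset.mem_singleton.1 h2)
      simp only [Finset.mem_filter, Finset.mem_powerset, Finset.insert_subset_iff,
        Finset.singleton_subset_iff]
      refine ⟨by rwa [← Finset.subset_insert_iff], ⟨Finset.mem_erase.2 ⟨huw, h2⟩,
        mem_of_leaf hx h3 h1 hwC hne⟩, cutConn_erase_leaf hx h3 h1⟩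
    · apply Finset.mem_union_left
      simp only [Finset.mem_filter, Finset.mem_powerset, Finset.singleton_subset_iff]
      exact ⟨(Finset.subset_insert_iff_of_notMem hwC).1 h1, h2, h3⟩
  exact (Finset.card_le_card this).trans ((Finset.card_union_le _ _).trans
    (Nat.add_le_add_left Finset.card_image_le _))

lemma cntF_step {B : Finset V} {x w : V}
    (hx : ∀ y ∈ B, G.Adj y w → y = x) :
    cntF G (insert w B) ≤ cntF G B + (1 + cntU G B {x}) := by
  have : (insert w B).powerset.filter (fun C => C.Nonempty ∧ CutConn G C) ⊆
      (B.powerset.filter (fun C => C.Nonempty ∧ CutConn G C)) ∪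
      (insert {w} ((B.powerset.filter (fun C => {x} ⊆ C ∧ CutConn G C)).image (fun C => insert w C))) := by
    intro C hC
    simp only [Finset.mem_filter, Finset.mem_powerset] at hC
    obtain ⟨h1, h2, h3⟩ := hC
    by_cases hwC : w ∈ C
    · apply Finset.mem_union_right
      by_cases hne : C = {w}
      · simp [hne]
      refine Finset.mem_insert_of_mem (Finset.mem_image.2 ⟨C.erase w, ?_, Finset.insert_erase hwC⟩)
      simp only [Finset.mem_filter, Finset.mem_powerset, Finset.singleton_subset_iff]
      refine ⟨by rwa [← Finset.subset_insert_iff], 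
        mem_of_leaf hx h3 h1 hwC hne, cutConn_erase_leaf hx h3 h1⟩
    · apply Finset.mem_union_left
      simp only [Finset.mem_filter, Finset.mem_powerset]
      exact ⟨(Finset.subset_insert_iff_of_notMem hwC).1 h1, h2, h3⟩
  refine (Finset.card_le_card this).trans ((Finset.card_union_le _ _).trans
    (Nat.add_le_add_left ((Finset.card_insert_le _ _).trans ?_) _))
  rw [add_comm]
  exact Nat.add_le_add_left Finset.card_image_le _

lemma cntU_subset_Icc (B U : Finset V) :
    B.powerset.filter (fun C => U ⊆ C ∧ CutConn G C) ⊆ Finset.Icc U B := by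
  intro C hC
  simp only [Finset.mem_filter, Finset.mem_powerset] at hC
  exact Finset.mem_Icc.2 ⟨hC.2.1, hC.1⟩

lemma cntU_le {B U : Finset V} (h : U ⊆ B) : cntU G B U ≤ 2 ^ (B.card - U.card) := by
  rw [← Finset.card_Icc_finset h]
  exact Finset.card_le_card (cntU_subset_Icc B U)

lemma cntU_eq {B U C : Finset V} (h : U ⊆ B) (he : cntU G B U = 2 ^ (B.card - U.card))
    (h1 : U ⊆ C) (h2 : C ⊆ B) : CutConn G C := by
  have := Finset.eq_of_subset_of_card_le (cntU_subset_Icc (G := G) B U)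
    (by rw [Finset.card_Icc_finset h, ← he]; rfl)
  have hC : C ∈ Finset.Icc U B := Finset.mem_Icc.2 ⟨h1, h2⟩
  rw [← this, Finset.mem_filter] at hC
  exact hC.2.2

lemma cntU_mono {B U : Finset V} {u : V} (hu : u ∈ U) : cntU G B U ≤ cntU G B {u} := by
  apply Finset.card_le_card
  intro C hC
  simp only [Finset.mem_filter, Finset.mem_powerset, Finset.singleton_subset_iff] at hC ⊢
  exact ⟨hC.1, hC.2.1 hu, hC.2.2⟩

lemma cntU_pair_eq {B : Finset V} {u x : V} (hu : u ∈ B)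
    (he : cntU G B {u, x} = cntU G B {u}) : x = u := by
  have hs : B.powerset.filter (fun C => {u, x} ⊆ C ∧ CutConn G C) ⊆
      B.powerset.filter (fun C => {u} ⊆ C ∧ CutConn G C) := by
    intro C hC
    simp only [Finset.mem_filter, Finset.mem_powerset, Finset.singleton_subset_iff,
      Finset.insert_subset_iff] at hC ⊢
    exact ⟨hC.1, hC.2.1.1, hC.2.2⟩
  have := Finset.eq_of_subset_of_card_le hs (le_of_eq he.symm)
  have h2 : {u} ∈ B.powerset.filter (fun C => {u} ⊆ C ∧ CutConn G C) := by
    simp [hu, cutConn_singleton]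
  rw [← this] at h2
  simp only [Finset.mem_filter, Finset.insert_subset_iff] at h2
  simpa using h2.2.1.2

lemma eq_singleton_of_side {B : Finset V} {u : V} {S : V → Prop}
    (hbip : ∀ u v : V, G.Adj u v → (S u ↔ ¬ S v)) (hB : CutConn G B) (hu : u ∈ B) (hS : S u)
    (hQ : (B.filter (fun v => ¬ S v)).card = 0) : B = {u} := by
  by_contra hne
  obtain ⟨b, hb, c, hc, hcD, ha⟩ := hB {u} (by simpa using hu) (by simp) (Ne.symm hne)
  simp only [Finset.mem_singleton] at hb hcD
  subst hb
  have : c ∈ B.filter (fun v => ¬ S v) := Finset.mem_filter.2 ⟨hc, (hbip _ _ ha).1 hS⟩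
  rw [Finset.card_eq_zero.1 hQ] at this
  simp at this
lemma cntU_bound (hG : G.IsAcyclic) {S : V → Prop}
    (hbip : ∀ u v : V, G.Adj u v → (S u ↔ ¬ S v)) {u : V} (hS : S u) (n : ℕ) :
    ∀ (A : Finset V) (m k : ℕ), A.card = n → CutConn G A → u ∈ A →
      (A.filter S).card = m + 1 → (A.filter (fun v => ¬ S v)).card = k + 1 →
      cntU G A {u} ≤ 2 ^ k + 2 ^ (m + k) ∧
      (cntU G A {u} = 2 ^ k + 2 ^ (m + k) →
        (∀ y ∈ A, ¬ S y → G.Adj u y) ∧ ∃ b ∈ A, ¬ S b ∧ ∀ y ∈ A, S y → G.Adj b y) := by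
  induction n with
  | zero =>
    intro A m k hn hA hu
    rw [Finset.card_eq_zero.1 hn] at hu
    simp at hu
  | succ n ih =>
    intro A m k hn hA hu hm hk
    have hne : A ≠ {u} := by
      rintro rfl
      rw [Finset.filter_singleton, if_neg (by simpa using hS)] at hk
      simp at hk
    obtain ⟨B, x, w, hB, huB, hxB, hw, rfl, hadj, huniq⟩ := exists_leaf hG hA hu hne
    rw [Finset.card_insert_of_notMem hw] at hn
    have hn' : B.card = n := by omega
    have hstep := cntU_step (G := G) huB hw huniq
    have hpart : (B.filter S).card + (B.filter (fun v => ¬ S v)).card = B.card :=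
      Finset.card_filter_add_card_filter_not S
    have hPB : 0 < (B.filter S).card := Finset.card_pos.2 ⟨u, Finset.mem_filter.2 ⟨huB, hS⟩⟩
    by_cases hSw : S w
    · have hSx : ¬ S x := fun h => ((hbip x w hadj).1 h) hSw
      have hux : u ≠ x := fun h => hSx (h ▸ hS)
      rw [Finset.filter_insert, if_pos hSw, Finset.card_insert_of_notMem (by simp [hw])] at hm
      rw [Finset.filter_insert, if_neg (by simpa using hSw)] at hk
      obtain ⟨m', rfl⟩ : ∃ m', m = m' + 1 := ⟨m - 1, by omega⟩
      obtain ⟨i1, i2⟩ := ih B m' k hn' hB huB (by omega) hk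
      have hsub : ({u, x} : Finset V) ⊆ B := by
        simp [Finset.insert_subset_iff, huB, hxB]
      have hc2 : ({u, x} : Finset V).card = 2 := Finset.card_pair hux
      have hle := cntU_le (G := G) hsub
      have hexp : B.card - ({u, x} : Finset V).card = m' + k := by omega
      have hpow : 2 ^ (m' + 1 + k) = 2 ^ (m' + k) + 2 ^ (m' + k) := by ring
      have hle2 := hle
      rw [hexp] at hle2
      refine ⟨by omega, fun heq => ?_⟩
      obtain ⟨j1, -⟩ := i2 (by omega)
      refine ⟨?_, x, by simp [hxB], hSx, ?_⟩
      · intro y hy hSy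
        rcases Finset.mem_insert.1 hy with rfl | hy
        · exact absurd hSw hSy
        · exact j1 y hy hSy
      · intro y hy hSy
        rcases Finset.mem_insert.1 hy with rfl | hy
        · exact hadj
        · by_cases hyu : y = u
          · subst hyu
            exact (j1 x hxB hSx).symm
          have hC := cntU_eq (G := G) (C := {u, x, y}) hsub (by rw [hexp]; omega)
            (by simp [Finset.insert_subset_iff])
            (by simp [Finset.insert_subset_iff, huB, hxB, hy])
          obtain ⟨b, hb, c, hc, hcD, ha⟩ := hC {y} (by simp) (by simp)
            (by
              intro h
              have : u ∈ ({y} : Finset V) := by rw [h]; simp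
              exact hyu (Finset.mem_singleton.1 this).symm)
          simp only [Finset.mem_singleton] at hb hcD
          subst hb
          simp only [Finset.mem_insert, Finset.mem_singleton] at hc
          rcases hc with rfl | rfl | rfl
          · exact absurd hS ((hbip _ _ ha).1 hSy)
          · exact ha.symm
          · exact absurd rfl hcD
    · rw [Finset.filter_insert, if_neg hSw] at hm
      rw [Finset.filter_insert, if_pos hSw, Finset.card_insert_of_notMem (by simp [hw])] at hk
      rcases Nat.eq_zero_or_pos k with rfl | hkpos
      · have hBu := eq_singleton_of_side hbip hB huB hS (by omega)
        subst hBu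
        have hxu : x = u := by simpa using hxB
        subst hxu
        have hm0 : m = 0 := by
          simp at hpart hn'
          omega
        subst hm0
        have h1 := cntU_le (G := G) (B := {x}) (U := {x}) (by simp)
        have h2 := cntU_mono (G := G) (B := {x}) (U := {x, x}) (u := x) (by simp)
        simp only [Nat.sub_self, pow_zero] at h1
        refine ⟨by simp; omega, fun _ => ⟨?_, w, by simp, hSw, ?_⟩⟩
        · intro y hy hSy
          simp only [Finset.mem_insert, Finset.mem_singleton] at hy
          rcases hy with rfl | rfl
          · exact hadj
          · exact absurd hS hSy
        · intro y hy hSy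
          simp only [Finset.mem_insert, Finset.mem_singleton] at hy
          rcases hy with rfl | rfl
          · exact absurd hSy hSw
          · exact hadj.symm
      · obtain ⟨k', rfl⟩ : ∃ k', k = k' + 1 := ⟨k - 1, by omega⟩
        obtain ⟨i1, i2⟩ := ih B m k' hn' hB huB hm (by omega)
        have hmono := cntU_mono (G := G) (B := B) (U := {u, x}) (u := u) (by simp)
        have hpow : 2 ^ (m + (k' + 1)) = 2 ^ (m + k') + 2 ^ (m + k') := by ring
        have hpow2 : 2 ^ (k' + 1) = 2 ^ k' + 2 ^ k' := by ring
        refine ⟨by omega, fun heq => ?_⟩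
        obtain ⟨j1, b, hb, hSb, hbb⟩ := i2 (by omega)
        have hxu := cntU_pair_eq (G := G) (x := x) huB (by omega)
        subst hxu
        refine ⟨?_, b, by simp [hb], hSb, ?_⟩
        · intro y hy hSy
          rcases Finset.mem_insert.1 hy with rfl | hy
          · exact hadj
          · exact j1 y hy hSy
        · intro y hy hSy
          rcases Finset.mem_insert.1 hy with rfl | hy
          · exact absurd hSy hSw
          · exact hbb y hy hSy

/-- Induction step for the main bound, when the removed leaf is outside `S`. -/
lemma cntF_bound_step (hG : G.IsAcyclic) {S : V → Prop}
    (hbip : ∀ u v : V, G.Adj u v → (S u ↔ ¬ S v)) {B : Finset V} {x w : V} {m k : ℕ}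
    (ih : ∀ m k, (B.filter S).card = m + 1 → (B.filter (fun v => ¬ S v)).card = k + 1 →
      cntF G B ≤ m + k + 2 ^ m + 2 ^ k + 2 ^ (m + k))
    (hB : CutConn G B) (hxB : x ∈ B) (hw : w ∉ B) (hadj : G.Adj x w)
    (huniq : ∀ y ∈ B, G.Adj y w → y = x) (hSw : ¬ S w)
    (hm : ((insert w B).filter S).card = m + 1)
    (hk : ((insert w B).filter (fun v => ¬ S v)).card = k + 1) :
    cntF G (insert w B) ≤ m + k + 2 ^ m + 2 ^ k + 2 ^ (m + k) ∧
      (cntF G (insert w B) = m + k + 2 ^ m + 2 ^ k + 2 ^ (m + k) →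
        ∃ a ∈ insert w B, ∃ b ∈ insert w B, S a ∧ ¬ S b ∧
          (∀ y ∈ insert w B, ¬ S y → G.Adj a y) ∧ (∀ y ∈ insert w B, S y → G.Adj b y)) := by
  have hSx : S x := (hbip x w hadj).2 hSw
  have hstep := cntF_step (G := G) huniq
  have hpart : (B.filter S).card + (B.filter (fun v => ¬ S v)).card = B.card :=
    Finset.card_filter_add_card_filter_not S
  rw [Finset.filter_insert, if_neg hSw] at hm
  rw [Finset.filter_insert, if_pos hSw, Finset.card_insert_of_notMem (by simp [hw])] at hk
  rcases Nat.eq_zero_or_pos k with rfl | hkpos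
  · have hBu := eq_singleton_of_side hbip hB hxB hSx (by omega)
    subst hBu
    have hm0 : m = 0 := by
      simp at hpart
      omega
    subst hm0
    have h1 := cntU_le (G := G) (B := {x}) (U := {x}) (by simp)
    simp only [Nat.sub_self, pow_zero] at h1
    have h2 : cntF G {x} ≤ 1 := by
      unfold cntF
      rw [Finset.card_le_one]
      intro C hC D hD
      simp only [Finset.mem_filter, Finset.mem_powerset] at hC hD
      rw [(Finset.Nonempty.subset_singleton_iff hC.2.1).1 hC.1,
        (Finset.Nonempty.subset_singleton_iff hD.2.1).1 hD.1]
    refine ⟨by simp; omega, fun _ => ⟨x, by simp, w, by simp, hSx, hSw, ?_, ?_⟩⟩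
    · intro y hy hSy
      simp only [Finset.mem_insert, Finset.mem_singleton] at hy
      rcases hy with rfl | rfl
      · exact hadj
      · exact absurd hSx hSy
    · intro y hy hSy
      simp only [Finset.mem_insert, Finset.mem_singleton] at hy
      rcases hy with rfl | rfl
      · exact absurd hSy hSw
      · exact hadj.symm
  · obtain ⟨k', rfl⟩ : ∃ k', k = k' + 1 := ⟨k - 1, by omega⟩
    have i1 := ih m k' hm (by omega)
    obtain ⟨f1, f2⟩ := cntU_bound hG hbip hSx _ B m k' rfl hB hxB hm (by omega)
    have hpow : 2 ^ (m + (k' + 1)) = 2 ^ (m + k') + 2 ^ (m + k') := by ring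
    have hpow2 : 2 ^ (k' + 1) = 2 ^ k' + 2 ^ k' := by ring
    refine ⟨by omega, fun heq => ?_⟩
    obtain ⟨j1, b, hb, hSb, hbb⟩ := f2 (by omega)
    refine ⟨x, by simp [hxB], b, by simp [hb], hSx, hSb, ?_, ?_⟩
    · intro y hy hSy
      rcases Finset.mem_insert.1 hy with rfl | hy
      · exact hadj
      · exact j1 y hy hSy
    · intro y hy hSy
      rcases Finset.mem_insert.1 hy with rfl | hy
      · exact absurd hSy hSw
      · exact hbb y hy hSy

lemma cntF_bound (hG : G.IsAcyclic) {S : V → Prop}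
    (hbip : ∀ u v : V, G.Adj u v → (S u ↔ ¬ S v)) (n : ℕ) :
    ∀ (A : Finset V) (m k : ℕ), A.card = n → CutConn G A →
      (A.filter S).card = m + 1 → (A.filter (fun v => ¬ S v)).card = k + 1 →
      cntF G A ≤ m + k + 2 ^ m + 2 ^ k + 2 ^ (m + k) ∧
      (cntF G A = m + k + 2 ^ m + 2 ^ k + 2 ^ (m + k) →
        ∃ a ∈ A, ∃ b ∈ A, S a ∧ ¬ S b ∧
          (∀ y ∈ A, ¬ S y → G.Adj a y) ∧ (∀ y ∈ A, S y → G.Adj b y)) := by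
  induction n with
  | zero =>
    intro A m k hn hA hm
    rw [Finset.card_eq_zero.1 hn] at hm
    simp at hm
  | succ n ih =>
    intro A m k hn hA hm hk
    obtain ⟨u, hu⟩ : (A.filter S).Nonempty := Finset.card_pos.1 (by omega)
    rw [Finset.mem_filter] at hu
    obtain ⟨hu, hS⟩ := hu
    have hne : A ≠ {u} := by
      rintro rfl
      rw [Finset.filter_singleton, if_neg (by simpa using hS)] at hk
      simp at hk
    obtain ⟨B, x, w, hB, huB, hxB, hw, rfl, hadj, huniq⟩ := exists_leaf hG hA hu hne
    rw [Finset.card_insert_of_notMem hw] at hn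
    have hn' : B.card = n := by omega
    by_cases hSw : S w
    · have hbip' : ∀ u v : V, G.Adj u v → (¬ S u ↔ ¬ ¬ S v) := fun u v h => by
        rw [hbip u v h]
      have key := cntF_bound_step (S := fun v => ¬ S v) (m := k) (k := m) hG hbip'
        (fun k m h1 h2 => by
          have := (ih B m k hn' hB (by simpa using h2) (by convert h1)).1
          rw [add_comm k m]
          omega) hB hxB hw hadj huniq (by simpa using hSw) (by convert hk) (by simpa using hm)
      rw [add_comm k m] at key
      refine ⟨by omega, fun heq => ?_⟩
      obtain ⟨a, ha, b, hb, h1, h2, h3, h4⟩ := key.2 (by omega)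
      simp only [not_not] at h2 h3
      exact ⟨b, hb, a, ha, h2, h1, h4, h3⟩
    · exact cntF_bound_step hG hbip (fun m k h1 h2 => (ih B m k hn' hB h1 h2).1) hB hxB hw hadj
        huniq hSw hm hk

lemma numSubtrees_eq [Fintype V] (G : SimpleGraph V) : numSubtrees G = cntF G Finset.univ := by
  unfold numSubtrees cntF
  rw [← Set.ncard_coe_finset]
  symm
  apply Set.ncard_congr (fun (C : Finset V) _ => (C : Set V))
  · intro C hC
    simp only [Finset.coe_filter, Finset.mem_powerset, Set.mem_ofPred_eq] at hC
    exact ⟨by simpa using hC.2.1, connected_of_cutConn hC.2.1 hC.2.2⟩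
  · intro C D _ _ h
    exact Finset.coe_injective h
  · intro T hT
    refine ⟨T.toFinset, ?_, by simp⟩
    simp only [Finset.coe_filter, Finset.mem_powerset, Set.mem_ofPred_eq]
    refine ⟨Finset.subset_univ _, by simpa using hT.1, cutConn_of_connected ?_⟩
    have : ((T.toFinset : Finset V) : Set V) = T := by simp
    rw [this]
    exact hT.2

/-- Sets in which every vertex is one of, or adjacent to one of, two adjacent centers. -/
lemma cutConn_of_centers {C : Finset V} {c d : V} (hc : c ∈ C) (hd : d ∈ C)
    (hcd : c = d ∨ G.Adj c d)
    (h : ∀ y ∈ C, y = c ∨ y = d ∨ G.Adj c y ∨ G.Adj d y) : CutConn G C := by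
  intro B hB hne hBC
  obtain ⟨z, hz, hzB⟩ : ∃ c ∈ C, c ∉ B := by
    by_contra! hh
    exact hBC (Finset.Subset.antisymm hB hh)
  obtain ⟨b, hb⟩ := hne
  by_contra! hno
  have hno' : ∀ b ∈ C, ∀ c ∈ C, G.Adj b c → (b ∈ B ↔ c ∈ B) := by
    intro b hb c hc hadj
    constructor
    · intro h1
      by_contra h2
      exact hno b h1 c hc h2 hadj
    · intro h1
      by_contra h2
      exact hno c h1 b hb h2 hadj.symm
  have hcd' : c ∈ B ↔ d ∈ B := by
    rcases hcd with rfl | h1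
    · rfl
    · exact hno' c hc d hd h1
  have hall : ∀ y ∈ C, (y ∈ B ↔ c ∈ B) := by
    intro y hy
    rcases h y hy with rfl | rfl | h1 | h1
    · rfl
    · exact hcd'.symm
    · exact (hno' _ hc _ hy h1).symm
    · rw [hcd']; exact (hno' _ hd _ hy h1).symm
  exact hzB ((hall z hz).2 ((hall b (hB hb)).1 hb))

lemma doubleStar_lower (m k : ℕ) :
    m + k + 2 ^ m + 2 ^ k + 2 ^ (m + k) ≤ cntF (doubleStar (m + 1) (k + 1)) Finset.univ := by
  let c : Fin (m + 1) ⊕ Fin (k + 1) := Sum.inl 0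
  let d : Fin (m + 1) ⊕ Fin (k + 1) := Sum.inr 0
  let L : Finset (Fin (m + 1) ⊕ Fin (k + 1)) := Finset.univ.map Function.Embedding.inl
  let R : Finset (Fin (m + 1) ⊕ Fin (k + 1)) := Finset.univ.map Function.Embedding.inr
  let F1 := ((Finset.univ : Finset (Fin (m + 1) ⊕ Fin (k + 1))) \ {c, d}).image (fun v => ({v} : Finset _))
  let F2 := Finset.Icc {c} L
  let F3 := Finset.Icc {d} R
  let F4 := Finset.Icc {c, d} (Finset.univ : Finset (Fin (m + 1) ⊕ Fin (k + 1)))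
  have hcd : c ≠ d := by simp [c, d]
  have hcL : c ∈ L := by simp [c, L]
  have hdR : d ∈ R := by simp [d, R]
  have hcR : c ∉ R := by simp [c, R]
  have hdL : d ∉ L := by simp [d, L]
  have c1 : F1.card = m + k := by
    rw [Finset.card_image_of_injective _ Finset.singleton_injective,
      Finset.card_sdiff_of_subset (Finset.subset_univ _), Finset.card_pair hcd]
    simp
    omega
  have c2 : F2.card = 2 ^ m := by
    rw [Finset.card_Icc_finset (by simpa using hcL)]
    simp [L]
  have c3 : F3.card = 2 ^ k := by
    rw [Finset.card_Icc_finset (by simpa using hdR)]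
    simp [R]
  have c4 : F4.card = 2 ^ (m + k) := by
    rw [Finset.card_Icc_finset (Finset.subset_univ _), Finset.card_pair hcd]
    simp
    omega
  have m1 : ∀ C ∈ F1, c ∉ C ∧ d ∉ C := by
    intro C hC
    simp only [F1, Finset.mem_image, Finset.mem_sdiff, Finset.mem_insert, Finset.mem_singleton,
      not_or] at hC
    obtain ⟨v, ⟨_, h1, h2⟩, rfl⟩ := hC
    simp only [Finset.mem_singleton]
    exact ⟨fun h => h1 h.symm, fun h => h2 h.symm⟩
  have m2 : ∀ C ∈ F2, c ∈ C ∧ d ∉ C := by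
    intro C hC
    have := Finset.mem_Icc.1 hC
    exact ⟨this.1 (by simp), fun h => hdL (this.2 h)⟩
  have m3 : ∀ C ∈ F3, c ∉ C ∧ d ∈ C := by
    intro C hC
    have := Finset.mem_Icc.1 hC
    exact ⟨fun h => hcR (this.2 h), this.1 (by simp)⟩
  have m4 : ∀ C ∈ F4, c ∈ C ∧ d ∈ C := by
    intro C hC
    have := Finset.mem_Icc.1 hC
    exact ⟨this.1 (by simp), this.1 (by simp)⟩
  have d12 : Disjoint F1 F2 := Finset.disjoint_left.2 fun C h1 h2 => (m1 C h1).1 (m2 C h2).1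
  have d123 : Disjoint (F1 ∪ F2) F3 := Finset.disjoint_left.2 fun C h1 h2 => by
    have := m3 C h2
    rcases Finset.mem_union.1 h1 with h | h
    · exact (m1 C h).2 this.2
    · exact (m2 C h).2 this.2
  have d1234 : Disjoint (F1 ∪ F2 ∪ F3) F4 := Finset.disjoint_left.2 fun C h1 h2 => by
    have := m4 C h2
    rcases Finset.mem_union.1 h1 with h | h
    · rcases Finset.mem_union.1 h with h | h
      · exact (m1 C h).2 this.2
      · exact (m2 C h).2 this.2
    · exact (m3 C h).1 this.1
  have adjc : ∀ i : Fin (m + 1), Sum.inl i = c ∨ (doubleStar (m + 1) (k + 1)).Adj c (Sum.inl i) := by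
    intro i
    by_cases h : i = 0
    · left; rw [h]
    · right
      simp [doubleStar, SimpleGraph.fromRel_adj, c, Ne.symm h]
  have adjd : ∀ i : Fin (k + 1), Sum.inr i = d ∨ (doubleStar (m + 1) (k + 1)).Adj d (Sum.inr i) := by
    intro i
    by_cases h : i = 0
    · left; rw [h]
    · right
      simp [doubleStar, SimpleGraph.fromRel_adj, d, Ne.symm h]
  have adjcd : (doubleStar (m + 1) (k + 1)).Adj c d := by
    simp [doubleStar, SimpleGraph.fromRel_adj, c, d]
  have hsub : F1 ∪ F2 ∪ F3 ∪ F4 ⊆ (Finset.univ : Finset (Fin (m + 1) ⊕ Fin (k + 1))).powerset.filter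
      (fun C => C.Nonempty ∧ CutConn (doubleStar (m + 1) (k + 1)) C) := by
    intro C hC
    simp only [Finset.mem_filter, Finset.mem_powerset, Finset.subset_univ, true_and]
    simp only [Finset.mem_union] at hC
    rcases hC with ((h | h) | h) | h
    · simp only [F1, Finset.mem_image] at h
      obtain ⟨v, _, rfl⟩ := h
      exact ⟨by simp, cutConn_singleton v⟩
    · refine ⟨⟨c, (m2 C h).1⟩, cutConn_of_centers (m2 C h).1 (m2 C h).1 (Or.inl rfl) ?_⟩
      intro y hy
      have := (Finset.mem_Icc.1 h).2 hy
      simp only [L, Finset.mem_map, Finset.mem_univ, true_and] at this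
      obtain ⟨i, rfl⟩ := this
      rcases adjc i with h5 | h5
      · exact Or.inl h5
      · exact Or.inr (Or.inr (Or.inl h5))
    · refine ⟨⟨d, (m3 C h).2⟩, cutConn_of_centers (m3 C h).2 (m3 C h).2 (Or.inl rfl) ?_⟩
      intro y hy
      have := (Finset.mem_Icc.1 h).2 hy
      simp only [R, Finset.mem_map, Finset.mem_univ, true_and] at this
      obtain ⟨i, rfl⟩ := this
      rcases adjd i with h5 | h5
      · exact Or.inl h5
      · exact Or.inr (Or.inr (Or.inl h5))
    · refine ⟨⟨c, (m4 C h).1⟩, cutConn_of_centers (m4 C h).1 (m4 C h).2 (Or.inr adjcd) ?_⟩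
      rintro (i | i) hy
      · rcases adjc i with h5 | h5
        · exact Or.inl h5
        · exact Or.inr (Or.inr (Or.inl h5))
      · rcases adjd i with h5 | h5
        · exact Or.inr (Or.inl h5)
        · exact Or.inr (Or.inr (Or.inr h5))
  have := Finset.card_le_card hsub
  rw [Finset.card_union_of_disjoint d1234, Finset.card_union_of_disjoint d123,
    Finset.card_union_of_disjoint d12, c1, c2, c3, c4] at this
  exact this

lemma exists_equiv_fin {α : Type*} [Fintype α] {m : ℕ} (h : Fintype.card α = m + 1) (a : α) :
    ∃ e : α ≃ Fin (m + 1), ∀ x, e x = 0 ↔ x = a := by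
  let e0 := Fintype.equivFinOfCardEq h
  refine ⟨e0.trans (Equiv.swap (e0 a) 0), fun x => ?_⟩
  rw [Equiv.trans_apply, Equiv.swap_apply_eq_iff, Equiv.swap_apply_right, e0.apply_eq_iff_eq]

lemma adj_iff_of_centers (hG : G.IsAcyclic) {S : V → Prop}
    (hbip : ∀ u v : V, G.Adj u v → (S u ↔ ¬ S v)) {a b : V} (ha : S a) (hb : ¬ S b)
    (h1 : ∀ y, ¬ S y → G.Adj a y) (h2 : ∀ y, S y → G.Adj b y) {u v : V} (hu : S u) (hv : ¬ S v) :
    G.Adj u v ↔ u = a ∨ v = b := by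
  constructor
  · intro h
    by_contra! hh
    have hB : CutConn G {a, b, u} := by
      apply cutConn_of_centers (c := b) (d := b) (by simp) (by simp) (Or.inl rfl)
      intro y hy
      simp only [Finset.mem_insert, Finset.mem_singleton] at hy
      rcases hy with rfl | rfl | rfl
      · exact Or.inr (Or.inr (Or.inl (h2 _ ha)))
      · exact Or.inl rfl
      · exact Or.inr (Or.inr (Or.inl (h2 _ hu)))
    refine hh.1 (unique_nbr hG hB (x := a) (y := u) (w := v) (by simp) (by simp) ?_ (h1 v hv) h)
    simp only [Finset.mem_insert, Finset.mem_singleton, not_or]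
    refine ⟨?_, hh.2, ?_⟩
    · rintro rfl; exact hv ha
    · rintro rfl; exact hv hu
  · rintro (rfl | rfl)
    · exact h1 v hv
    · exact (h2 u hu).symm

lemma doubleStar_adj_swap_ll {m k : ℕ} (i j : Fin (m + 1)) :
    (doubleStar (m + 1) (k + 1)).Adj (if i = 0 then Sum.inr 0 else Sum.inl i)
      (if j = 0 then Sum.inr 0 else Sum.inl j) ↔ False := by
  by_cases hi : i = 0 <;> by_cases hj : j = 0 <;>
    simp [doubleStar, SimpleGraph.fromRel_adj, hi, hj]

lemma doubleStar_adj_swap_rr {m k : ℕ} (i j : Fin (k + 1)) :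
    (doubleStar (m + 1) (k + 1)).Adj (if i = 0 then Sum.inl 0 else Sum.inr i)
      (if j = 0 then Sum.inl 0 else Sum.inr j) ↔ False := by
  by_cases hi : i = 0 <;> by_cases hj : j = 0 <;>
    simp [doubleStar, SimpleGraph.fromRel_adj, hi, hj]

lemma doubleStar_adj_swap_lr {m k : ℕ} (i : Fin (m + 1)) (j : Fin (k + 1)) :
    (doubleStar (m + 1) (k + 1)).Adj (if i = 0 then Sum.inr 0 else Sum.inl i)
      (if j = 0 then Sum.inl 0 else Sum.inr j) ↔ (i = 0 ∨ j = 0) := by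
  by_cases hi : i = 0 <;> by_cases hj : j = 0
  · simp [doubleStar, SimpleGraph.fromRel_adj, hi, hj]
  · simp [doubleStar, SimpleGraph.fromRel_adj, hi, hj, Ne.symm hj]
  · simp [doubleStar, SimpleGraph.fromRel_adj, hi, hj]
  · simp [doubleStar, SimpleGraph.fromRel_adj, hi, hj]

lemma iso_of_centers [Fintype V] (hG : G.IsAcyclic) {S : V → Prop}
    (hbip : ∀ u v : V, G.Adj u v → (S u ↔ ¬ S v)) {a b : V} (ha : S a) (hb : ¬ S b)
    (h1 : ∀ y, ¬ S y → G.Adj a y) (h2 : ∀ y, S y → G.Adj b y) {m k : ℕ}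
    (hm : Fintype.card {v // S v} = m + 1) (hk : Fintype.card {v // ¬ S v} = k + 1) :
    Nonempty (G ≃g doubleStar (m + 1) (k + 1)) := by
  obtain ⟨e1, he1⟩ := exists_equiv_fin hm ⟨a, ha⟩
  obtain ⟨e2, he2⟩ := exists_equiv_fin hk ⟨b, hb⟩
  let D := doubleStar (m + 1) (k + 1)
  let sw : Equiv.Perm (Fin (m + 1) ⊕ Fin (k + 1)) := Equiv.swap (Sum.inl 0) (Sum.inr 0)
  have s1 : ∀ i, sw (Sum.inl i) = if i = 0 then Sum.inr 0 else Sum.inl i := by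
    intro i
    simp only [sw, Equiv.swap_apply_def]
    split_ifs <;> simp_all
  have s2 : ∀ i, sw (Sum.inr i) = if i = 0 then Sum.inl 0 else Sum.inr i := by
    intro i
    simp only [sw, Equiv.swap_apply_def]
    split_ifs <;> simp_all
  have key : ∀ x y : Fin (m + 1) ⊕ Fin (k + 1), D.Adj (sw x) (sw y) ↔
      match x, y with
      | Sum.inl i, Sum.inr j => i = 0 ∨ j = 0
      | Sum.inr j, Sum.inl i => i = 0 ∨ j = 0
      | _, _ => False := by
    rintro (i | i) (j | j)
    · simp only [s1, doubleStar_adj_swap_ll, D]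
    · simp only [s1, s2, doubleStar_adj_swap_lr, D]
    · rw [SimpleGraph.adj_comm]
      simp only [s1, s2, doubleStar_adj_swap_lr, D]
    · simp only [s2, doubleStar_adj_swap_rr, D]
  let E : V ≃ Fin (m + 1) ⊕ Fin (k + 1) :=
    ((Equiv.sumCompl S).symm.trans (Equiv.sumCongr e1 e2))
  have E1 : ∀ v (h : S v), E v = Sum.inl (e1 ⟨v, h⟩) := by
    intro v h
    simp [E, Equiv.sumCompl_symm_apply_of_pos h]
  have E2 : ∀ v (h : ¬ S v), E v = Sum.inr (e2 ⟨v, h⟩) := by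
    intro v h
    simp [E, Equiv.sumCompl_symm_apply_of_neg h]
  refine ⟨⟨E.trans sw, ?_⟩⟩
  intro u v
  change D.Adj (sw (E u)) (sw (E v)) ↔ _
  rw [key]
  by_cases hu : S u <;> by_cases hv : S v
  · rw [E1 u hu, E1 v hv]
    simp only [false_iff]
    intro h
    exact (hbip u v h).1 hu hv
  · rw [E1 u hu, E2 v hv, adj_iff_of_centers hG hbip ha hb h1 h2 hu hv]
    simp only [he1, he2, Subtype.mk.injEq]
  · rw [E2 u hu, E1 v hv, G.adj_comm, adj_iff_of_centers hG hbip ha hb h1 h2 hv hu]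
    simp only [he1, he2, Subtype.mk.injEq]
  · rw [E2 u hu, E2 v hv]
    simp only [false_iff]
    intro h
    exact hu ((hbip u v h).2 hv)

end helpers

/-- Among `n`-vertex trees with a `(p,q)`-bipartition (`1 ≤ p ≤ q`, `p + q = n`), the
double star `D(p,q)` uniquely maximizes the number of subtrees. -/
theorem doubleStar_max_numSubtrees (p q n : ℕ) (hp : 1 ≤ p) (hpq : p ≤ q) (hn : p + q = n)
    (V : Type) [Fintype V] (G : SimpleGraph V) (hG : G.IsTree)
    (hcard : Fintype.card V = n)
    (S : Set V) (hbip : ∀ u v : V, G.Adj u v → (u ∈ S ↔ v ∉ S)) (hS : S.ncard = p) :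
    numSubtrees G ≤ numSubtrees (doubleStar p q) ∧
      (numSubtrees G = numSubtrees (doubleStar p q) →
        Nonempty (G ≃g doubleStar p q)) := by
  classical
  obtain ⟨m, rfl⟩ : ∃ m, p = m + 1 := ⟨p - 1, by omega⟩
  obtain ⟨k, rfl⟩ : ∃ k, q = k + 1 := ⟨q - 1, by omega⟩
  have hm : (Finset.univ.filter (fun v => v ∈ S)).card = m + 1 := by
    rw [← hS, ← Set.ncard_coe_finset]
    congr 1
    ext v
    simp
  have hsum : (Finset.univ.filter (fun v => v ∈ S)).card +
      (Finset.univ.filter (fun v => ¬ v ∈ S)).card = (Finset.univ : Finset V).card :=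
    Finset.card_filter_add_card_filter_not _
  rw [Finset.card_univ] at hsum
  have hk : (Finset.univ.filter (fun v => ¬ v ∈ S)).card = k + 1 := by omega
  have hconn : CutConn G (Finset.univ : Finset V) := by
    apply cutConn_of_connected
    rw [Finset.coe_univ]
    exact (SimpleGraph.induceUnivIso G).connected_iff.2 hG.connected
  have hlow := doubleStar_lower m k
  have hb := cntF_bound (S := fun v => v ∈ S) hG.isAcyclic hbip _ Finset.univ m k rfl hconn
    (by convert hm) (by convert hk)
  rw [numSubtrees_eq, numSubtrees_eq]
  refine ⟨hb.1.trans hlow, fun heq => ?_⟩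
  obtain ⟨a, -, b, -, h1, h2, h3, h4⟩ := hb.2 (le_antisymm hb.1 (heq ▸ hlow))
  refine iso_of_centers (S := fun v => v ∈ S) hG.isAcyclic hbip h1 h2 (fun y => h3 y (Finset.mem_univ _))
    (fun y => h4 y (Finset.mem_univ _)) ?_ ?_
  · rw [Fintype.card_subtype]; convert hm
  · rw [Fintype.card_subtype]; convert hk
end

section
/- For n ≥ 2, the n-leaf binary caterpillar tree \hat{T}_{n-2}^3 has exactly 2^{n+1} + 2^{n-2} - n - 4 subtrees, and it minimizes the number of subtrees among all binary trees with n leaves (trees in which every non-leaf vertex has degree exactly 3). -/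
open SimpleGraph

/-- The caterpillar `q`-ary tree `\hat{T}_n^q`: the path `v_0 v_1 ... v_{n+1}` on `n + 2`
vertices together with `q - 2` pendant vertices attached to each internal vertex
`v_1, ..., v_n` (the leaf `(i, j)` is attached to `v_{i+1}`). -/
def caterpillar (n q : ℕ) : SimpleGraph (Fin (n + 2) ⊕ Fin n × Fin (q - 2)) :=
  SimpleGraph.fromRel (fun x y =>
    match x, y with
    | Sum.inl i, Sum.inl j => (i : ℕ) + 1 = (j : ℕ)
    | Sum.inr (i, _), Sum.inl j => (i : ℕ) + 1 = (j : ℕ)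
    | _, _ => False)

/-- number of connected vertex sets between `Q` and `A`. -/
noncomputable def cnt {V : Type*} (G : SimpleGraph V) (A Q : Set V) : ℕ :=
  {S : Set V | Q ⊆ S ∧ S ⊆ A ∧ (G.induce S).Connected}.ncard

lemma connected_of_map {α β : Type*} (H : SimpleGraph α) (K : SimpleGraph β) (f : α → β)
    (hf : Function.Surjective f) (h : ∀ a b, H.Adj a b → f a = f b ∨ K.Adj (f a) (f b))
    (hH : H.Connected) : K.Connected := by
  have key : ∀ a b, H.Reachable a b → K.Reachable (f a) (f b) := by
    rintro a b ⟨p⟩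
    induction p with
    | nil => exact Reachable.refl _
    | cons hadj _ ih =>
      rcases h _ _ hadj with h1 | h1
      · rw [h1]; exact ih
      · exact h1.reachable.trans ih
  have : Nonempty β := hH.nonempty.map f
  refine ⟨fun x y => ?_⟩
  obtain ⟨a, rfl⟩ := hf x
  obtain ⟨b, rfl⟩ := hf y
  exact key a b (hH.preconnected a b)

lemma conn_insert {V : Type*} (G : SimpleGraph V) {x v : V} {S : Set V} (hx : x ∉ S)
    (hv : v ∈ S) (hadj : G.Adj x v) (hS : (G.induce S).Connected) :
    (G.induce (insert x S)).Connected := by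
  have h := induce_union_connected (G := G) hS.preconnected
    (induce_pair_connected_of_adj hadj).preconnected ⟨v, hv, by simp⟩
  have e : S ∪ {x, v} = insert x S := by ext w; simp; grind
  rwa [e] at h

lemma conn_of_insert {V : Type*} (G : SimpleGraph V) {x v : V} {S : Set V} (hx : x ∉ S)
    (hne : S.Nonempty) (huniq : ∀ w ∈ S, G.Adj x w → w = v)
    (h : (G.induce (insert x S)).Connected) : v ∈ S ∧ (G.induce S).Connected := by
  classical
  obtain ⟨s, hs⟩ := hne
  have hv : v ∈ S := by
    have hsx : s ≠ x := fun e => hx (e ▸ hs)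
    obtain ⟨p⟩ := h.preconnected ⟨x, by simp⟩ ⟨s, by simp [hs]⟩
    cases p with
    | nil => exact absurd rfl hsx
    | @cons _ w _ hadj _ =>
      have h1 : G.Adj x w.1 := hadj
      have h2 : w.1 ∈ S := by
        rcases w.2 with h2 | h2
        · exact absurd h2.symm h1.ne
        · exact h2
      rw [← huniq _ h2 h1]; exact h2
  refine ⟨hv, ?_⟩
  refine connected_of_map (G.induce (insert x S)) (G.induce S)
    (fun a => if ha : a.1 ∈ S then ⟨a.1, ha⟩ else ⟨v, hv⟩) ?_ ?_ h
  · rintro ⟨b, hb⟩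
    exact ⟨⟨b, by simp [hb]⟩, by simp [hb]⟩
  · rintro ⟨a, ha⟩ ⟨b, hb⟩ hab
    have hab' : G.Adj a b := hab
    by_cases h1 : a ∈ S <;> by_cases h2 : b ∈ S
    · right; simpa [h1, h2] using hab'
    · have : b = x := by simpa [h2] using hb
      subst this
      left; simpa [h1, h2] using huniq a h1 hab'.symm
    · have : a = x := by simpa [h1] using ha
      subst this
      left; simpa [h1, h2] using (huniq b h2 hab').symm
    · left; simp [h1, h2]

lemma conn_singleton {V : Type*} (G : SimpleGraph V) (x : V) : (G.induce {x}).Connected := by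
  have : Nonempty ({x} : Set V) := ⟨⟨x, rfl⟩⟩
  refine ⟨fun a b => ?_⟩
  have : a = b := Subsingleton.elim _ _
  rw [this]

lemma conn_nonempty {V : Type*} {G : SimpleGraph V} {S : Set V}
    (h : (G.induce S).Connected) : S.Nonempty := by
  obtain ⟨a⟩ := h.nonempty
  exact ⟨a, a.2⟩

section
variable {V : Type*} [Finite V] (G : SimpleGraph V) {A : Set V} {x v : V}

lemma cnt_insert_aux (hx : x ∉ A) (hv : v ∈ A) (hadj : ∀ w ∈ A, G.Adj x w ↔ w = v)
    {Q : Set V} (hQ : Q ⊆ A) :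
    {S : Set V | insert x Q ⊆ S ∧ S ⊆ insert x A ∧ (G.induce S).Connected} =
      insert x '' {S : Set V | insert v Q ⊆ S ∧ S ⊆ A ∧ (G.induce S).Connected} ∪
      {S : Set V | S = {x} ∧ Q = ∅} := by
  ext S
  simp only [Set.mem_ofPred_eq, Set.mem_union, Set.mem_image]
  constructor
  · rintro ⟨h1, h2, h3⟩
    have hxS : x ∈ S := h1 (by simp)
    by_cases hne : (S \ {x}).Nonempty
    · left
      have e : insert x (S \ {x}) = S := by simp [Set.insert_eq_of_mem hxS]
      have hsub : S \ {x} ⊆ A := by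
        rintro w ⟨hw, hw'⟩
        rcases h2 hw with h | h
        · exact absurd h hw'
        · exact h
      obtain ⟨hvS, hc⟩ := conn_of_insert G (x := x) (v := v) (S := S \ {x}) (by simp) hne
        (fun w hw => (hadj w (hsub hw)).1) (by rw [e]; exact h3)
      refine ⟨S \ {x}, ⟨?_, hsub, hc⟩, e⟩
      rintro w (rfl | hw)
      · exact hvS
      · exact ⟨h1 (by simp [hw]), fun hh => hx (hh ▸ hQ hw)⟩
    · right
      have hS : S = {x} := by
        apply Set.Subset.antisymm
        · intro w hw
          by_contra hh
          exact hne ⟨w, hw, hh⟩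
        · simpa using hxS
      refine ⟨hS, ?_⟩
      by_contra hq
      obtain ⟨q, hq⟩ := Set.nonempty_iff_ne_empty.2 hq
      have : q ∈ S := h1 (by simp [hq])
      rw [hS] at this
      exact hx (this ▸ hQ hq)
  · rintro (⟨T, ⟨h1, h2, h3⟩, rfl⟩ | ⟨rfl, rfl⟩)
    · refine ⟨Set.insert_subset_insert ((Set.subset_insert _ _).trans h1),
        Set.insert_subset_insert h2, ?_⟩
      exact conn_insert G (fun h => hx (h2 h)) (h1 (by simp)) ((hadj v hv).2 rfl) h3
    · exact ⟨by simp, by simp, conn_singleton G x⟩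

lemma insert_injOn (hx : x ∉ A) (P : Set V → Prop) (Q : Set V) :
    Set.InjOn (insert x) {S : Set V | Q ⊆ S ∧ S ⊆ A ∧ P S} := by
  rintro S ⟨_, h2, _⟩ T ⟨_, h2', _⟩ e
  have hS : x ∉ S := fun h => hx (h2 h)
  have hT : x ∉ T := fun h => hx (h2' h)
  rw [← Set.insert_sdiff_self_of_notMem hS, ← Set.insert_sdiff_self_of_notMem hT]
  rw [e]

open Classical in
lemma cnt_insert_mem (hx : x ∉ A) (hv : v ∈ A) (hadj : ∀ w ∈ A, G.Adj x w ↔ w = v)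
    {Q : Set V} (hQ : Q ⊆ A) :
    cnt G (insert x A) (insert x Q) = cnt G A (insert v Q) + (if Q = ∅ then 1 else 0) := by
  unfold cnt
  rw [cnt_insert_aux G hx hv hadj hQ, Set.ncard_union_eq _ (Set.toFinite _) (Set.toFinite _),
    (insert_injOn hx _ _).ncard_image]
  · congr 1
    split_ifs with h
    · simp [h]
    · simp [h]
  · rw [Set.disjoint_left]
    rintro S ⟨T, ⟨h1, h2, h3⟩, rfl⟩ ⟨h4, h5⟩
    have : v ∈ ({x} : Set V) := h4 ▸ Set.mem_insert_of_mem _ (h1 (by simp))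
    exact hx (this ▸ hv)

open Classical in
lemma cnt_insert (hx : x ∉ A) (hv : v ∈ A) (hadj : ∀ w ∈ A, G.Adj x w ↔ w = v)
    {Q : Set V} (hQ : Q ⊆ A) :
    cnt G (insert x A) Q = cnt G A Q + cnt G A (insert v Q) + (if Q = ∅ then 1 else 0) := by
  rw [add_assoc, ← cnt_insert_mem G hx hv hadj hQ]
  unfold cnt
  rw [← Set.ncard_union_eq _ (Set.toFinite _) (Set.toFinite _)]
  · congr 1
    ext S
    simp only [Set.mem_ofPred_eq, Set.mem_union]
    constructor
    · rintro ⟨h1, h2, h3⟩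
      by_cases hxS : x ∈ S
      · exact Or.inr ⟨Set.insert_subset hxS h1, h2, h3⟩
      · exact Or.inl ⟨h1, (Set.subset_insert_iff_of_notMem hxS).1 h2, h3⟩
    · rintro (⟨h1, h2, h3⟩ | ⟨h1, h2, h3⟩)
      · exact ⟨h1, h2.trans (Set.subset_insert _ _), h3⟩
      · exact ⟨(Set.subset_insert _ _).trans h1, h2, h3⟩
  · rw [Set.disjoint_left]
    rintro S ⟨_, h2, _⟩ ⟨h1, _, _⟩
    exact hx (h2 (h1 (by simp)))

open Classical in
/-- attaching a cherry -/
lemma cnt_cherry {y : V} (hx : x ∉ A) (hy : y ∉ A) (hxy : x ≠ y) (hv : v ∈ A)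
    (hax : ∀ w, G.Adj x w ↔ w = v) (hay : ∀ w, G.Adj y w ↔ w = v)
    {Q : Set V} (hQ : Q ⊆ A) :
    cnt G (insert x (insert y A)) Q =
      cnt G A Q + 3 * cnt G A (insert v Q) + (if Q = ∅ then 2 else 0) := by
  rw [cnt_insert G (v := v) (by simp [hx, hxy]) (by simp [hv]) (fun w _ => hax w)
      (hQ.trans (Set.subset_insert _ _)),
    cnt_insert G (v := v) hy hv (fun w _ => hay w) hQ,
    cnt_insert G (v := v) hy hv (fun w _ => hay w) (Set.insert_subset hv hQ)]
  have : insert v Q ≠ ∅ := (Set.insert_nonempty _ _).ne_empty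
  simp only [Set.insert_idem, this, if_false]
  split_ifs <;> ring

lemma cnt_cherry_end {y : V} (hx : x ∉ A) (hy : y ∉ A) (hxy : x ≠ y) (hv : v ∈ A)
    (hax : ∀ w, G.Adj x w ↔ w = v) (hay : ∀ w, G.Adj y w ↔ w = v) :
    cnt G (insert x (insert y A)) {x} = 2 * cnt G A {v} + 1 := by
  have h := cnt_insert_mem G (x := x) (A := insert y A) (v := v) (Q := ∅)
    (by simp [hx, hxy]) (by simp [hv]) (fun w _ => hax w) (by simp)
  have h2 := cnt_insert G (v := v) hy hv (fun w _ => hay w) (Q := {v}) (by simpa using hv)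
  simp at h h2
  rw [h, h2]; ring
end

lemma cnt_embedding {V W : Type*} (G : SimpleGraph V) (H : SimpleGraph W) (φ : G ↪g H)
    (Q : Set V) : cnt G Set.univ Q = cnt H (Set.range φ) (φ '' Q) := by
  unfold cnt
  have : {S : Set W | φ '' Q ⊆ S ∧ S ⊆ Set.range φ ∧ (H.induce S).Connected} =
      (fun S => φ '' S) '' {S : Set V | Q ⊆ S ∧ S ⊆ Set.univ ∧ (G.induce S).Connected} := by
    have key : ∀ S : Set V, (H.induce (φ '' S)).Connected ↔ (G.induce S).Connected := by
      intro S
      have e : G.induce S ≃g H.induce (φ '' S) :=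
        { toEquiv := Equiv.Set.image φ S φ.injective
          map_rel_iff' := by
            rintro ⟨a, ha⟩ ⟨b, hb⟩
            simp [Equiv.Set.image_apply] }
      exact e.connected_iff.symm
    ext S
    simp only [Set.mem_ofPred_eq, Set.mem_image, Set.subset_univ, true_and]
    constructor
    · rintro ⟨h1, h2, h3⟩
      obtain ⟨T, rfl⟩ := Set.subset_range_iff_exists_image_eq.1 h2
      exact ⟨T, ⟨(Set.image_subset_image_iff φ.injective).1 h1, (key T).1 h3⟩, rfl⟩
    · rintro ⟨T, ⟨h1, h2⟩, rfl⟩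
      exact ⟨Set.image_mono h1, Set.image_subset_range _ _, (key T).2 h2⟩
  rw [this, Set.ncard_image_of_injective _ φ.injective.image_injective]

lemma numSubtrees_aux {V : Type*} (G : SimpleGraph V) :
    {S : Set V | S.Nonempty ∧ (G.induce S).Connected}.ncard = cnt G Set.univ ∅ := by
  unfold cnt
  congr 1
  ext S
  simp only [Set.mem_ofPred_eq, Set.empty_subset, Set.subset_univ, true_and]
  exact ⟨fun h => h.2, fun h => ⟨conn_nonempty h, h⟩⟩

lemma emb_cherry {V W : Type*} [Finite V] {G : SimpleGraph W} [Finite W] {H : SimpleGraph V}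
    (φ : G ↪g H) {x y : V} {v : W} (hr : ∀ w, w ∈ Set.range φ ↔ w ≠ x ∧ w ≠ y) (hxy : x ≠ y)
    (hax : ∀ w, H.Adj x w ↔ w = φ v) (hay : ∀ w, H.Adj y w ↔ w = φ v) :
    cnt H Set.univ ∅ = cnt G Set.univ ∅ + 3 * cnt G Set.univ {v} + 2 ∧
    (∀ r, cnt H Set.univ {φ r} = cnt G Set.univ {r} + 3 * cnt G Set.univ {v, r}) ∧
    cnt H Set.univ {x} = 2 * cnt G Set.univ {v} + 1 := by
  have hu : (Set.univ : Set V) = insert x (insert y (Set.range φ)) := by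
    ext w
    simp only [Set.mem_univ, Set.mem_insert_iff, hr, true_iff]
    tauto
  have hx : x ∉ Set.range φ := by rw [hr]; tauto
  have hy : y ∉ Set.range φ := by rw [hr]; tauto
  have hv : φ v ∈ Set.range φ := ⟨v, rfl⟩
  rw [hu]
  refine ⟨?_, fun r => ?_, ?_⟩
  · rw [cnt_cherry H hx hy hxy hv hax hay (Set.empty_subset _), cnt_embedding G H φ,
      cnt_embedding G H φ]
    simp
  · rw [cnt_cherry H hx hy hxy hv hax hay (by simp), cnt_embedding G H φ,
      cnt_embedding G H φ]
    simp [Set.image_insert_eq]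
  · rw [cnt_cherry_end H hx hy hxy hv hax hay, cnt_embedding G H φ]
    simp

lemma cnt_single {V : Type*} (G : SimpleGraph V) (v : V) {Q : Set V} (hQ : Q ⊆ {v}) :
    cnt G {v} Q = 1 := by
  unfold cnt
  rw [Set.ncard_eq_one]
  refine ⟨{v}, ?_⟩
  ext S
  simp only [Set.mem_ofPred_eq, Set.mem_singleton_iff]
  constructor
  · rintro ⟨_, h2, h3⟩
    rcases Set.subset_singleton_iff_eq.1 h2 with h | h
    · exact absurd h (conn_nonempty h3).ne_empty
    · exact h
  · rintro rfl
    exact ⟨hQ, subset_rfl, conn_singleton G v⟩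

lemma cat_inl_inl {n q : ℕ} (i j : Fin (n + 2)) :
    (caterpillar n q).Adj (Sum.inl i) (Sum.inl j) ↔
      (i : ℕ) + 1 = j ∨ (j : ℕ) + 1 = i := by
  simp only [caterpillar, fromRel_adj, ne_eq, Sum.inl.injEq, Fin.ext_iff]
  omega

lemma cat_inr_inl {n q : ℕ} (i : Fin n × Fin (q - 2)) (j : Fin (n + 2)) :
    (caterpillar n q).Adj (Sum.inr i) (Sum.inl j) ↔ (i.1 : ℕ) + 1 = j := by
  obtain ⟨i, a⟩ := i
  simp [caterpillar, fromRel_adj]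

lemma cat_inl_inr {n q : ℕ} (i : Fin n × Fin (q - 2)) (j : Fin (n + 2)) :
    (caterpillar n q).Adj (Sum.inl j) (Sum.inr i) ↔ (i.1 : ℕ) + 1 = j := by
  rw [adj_comm, cat_inr_inl]

lemma cat_inr_inr {n q : ℕ} (i j : Fin n × Fin (q - 2)) :
    ¬ (caterpillar n q).Adj (Sum.inr i) (Sum.inr j) := by
  simp [caterpillar, fromRel_adj]

/-- the smaller caterpillar sits in the next one -/
def catEmb (k : ℕ) : caterpillar k 3 ↪g caterpillar (k + 1) 3 where
  toFun := Sum.map Fin.castSucc (Prod.map Fin.castSucc id)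
  inj' := (Sum.map_injective.2 ⟨Fin.castSucc_injective _,
    (Fin.castSucc_injective _).prodMap Function.injective_id⟩)
  map_rel_iff' := by
    rintro (i | i) (j | j)
    · exact (cat_inl_inl _ _).trans (Iff.trans (by simp) (cat_inl_inl _ _).symm)
    · exact (cat_inl_inr _ _).trans (Iff.trans (by simp) (cat_inl_inr _ _).symm)
    · exact (cat_inr_inl _ _).trans (Iff.trans (by simp) (cat_inr_inl _ _).symm)
    · exact iff_of_false (cat_inr_inr _ _) (cat_inr_inr _ _)

lemma cat_cnt (k : ℕ) :
    cnt (caterpillar k 3) Set.univ {Sum.inl (Fin.last (k + 1))} + 1 = 3 * 2 ^ k ∧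
    cnt (caterpillar k 3) Set.univ ∅ + k + 6 = 9 * 2 ^ k := by
  induction k with
  | zero =>
    have hu : (Set.univ : Set (Fin (0 + 2) ⊕ Fin 0 × Fin (3 - 2))) =
        insert (Sum.inl 1) {Sum.inl 0} := by
      ext w
      rcases w with i | i
      · fin_cases i <;> simp
      · exact i.1.elim0
    have hadj : ∀ w ∈ ({Sum.inl 0} : Set (Fin (0 + 2) ⊕ Fin 0 × Fin (3 - 2))),
        (caterpillar 0 3).Adj (Sum.inl 1) w ↔ w = Sum.inl 0 := by
      rintro w rfl
      exact iff_of_true ((cat_inl_inl _ _).2 (by simp)) rfl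
    have h1 := cnt_insert_mem (caterpillar 0 3) (x := Sum.inl 1) (v := Sum.inl 0)
      (A := {Sum.inl 0}) (Q := ∅) (by simp) (by simp) hadj (by simp)
    have h2 := cnt_insert (caterpillar 0 3) (x := Sum.inl 1) (v := Sum.inl 0)
      (A := {Sum.inl 0}) (Q := ∅) (by simp) (by simp) hadj (by simp)
    rw [← hu, cnt_single _ _ (by simp)] at h1 h2
    rw [cnt_single _ _ (by simp)] at h2
    simp only [if_true] at h1 h2
    have e : (Fin.last (0 + 1)) = (1 : Fin (0 + 2)) := rfl
    rw [e, h2]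
    have e2 : (insert (Sum.inl 1) ∅ : Set (Fin (0 + 2) ⊕ Fin 0 × Fin (3 - 2))) = {Sum.inl 1} := by
      simp
    rw [e2] at h1
    rw [h1]
    norm_num
  | succ k ih =>
    obtain ⟨h1, -, h3⟩ := emb_cherry (catEmb k) (x := Sum.inl (Fin.last (k + 1 + 1)))
      (y := Sum.inr (Fin.last k, 0)) (v := Sum.inl (Fin.last (k + 1))) (by
        rintro (i | ⟨i, a⟩)
        · induction i using Fin.lastCases with
          | last =>
            simp only [catEmb]
            simp [Fin.ext_iff]
            intro a; have := a.2; omega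
          | cast i =>
            simp [catEmb, Fin.ext_iff]
            have := i.2; omega
        · induction i using Fin.lastCases with
          | last =>
            have : a = 0 := Subsingleton.elim (α := Fin 1) _ _
            subst this
            simp [catEmb, Fin.ext_iff]
            intro a; have := a.2; omega
          | cast i =>
            simp [catEmb, Fin.ext_iff]
            have := i.2; omega) (by simp) (by
        rintro (i | ⟨i, a⟩)
        · refine (cat_inl_inl _ _).trans ?_
          simp [catEmb, Fin.ext_iff]
          have := i.2; omega
        · refine (cat_inl_inr _ _).trans ?_
          simp [catEmb]
          have := i.2; omega) (by
        rintro (i | ⟨i, a⟩)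
        · refine (cat_inr_inl _ _).trans ?_
          simp [catEmb, Fin.ext_iff]
          have := i.2; omega
        · exact iff_of_false (cat_inr_inr _ _) (by simp [catEmb]))
    rw [h1, h3, pow_succ]
    omega

/-! ### Lower bound for trees -/

lemma conn_compl_leaves {V : Type*} [Finite V] {G : SimpleGraph V} (hG : G.Connected)
    (K : Set V) (hK : ∀ x ∈ K, (G.neighborSet x).ncard = 1) (r : V) (hr : r ∉ K) :
    (G.induce Kᶜ).Connected := by
  induction K, Set.toFinite K using Set.Finite.induction_on with
  | empty =>
    rw [Set.compl_empty]
    exact (induceUnivIso G).connected_iff.2 hG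
  | @insert x K hx _ ih =>
    have h1 := ih (fun y hy => hK y (by simp [hy])) (fun h => hr (by simp [h]))
    obtain ⟨v, hv⟩ := Set.ncard_eq_one.1 (hK x (by simp))
    have e : Kᶜ = insert x (insert x K)ᶜ := by
      ext w
      simp only [Set.mem_compl_iff, Set.mem_insert_iff]
      grind
    rw [e] at h1
    refine (conn_of_insert G (v := v) (by simp) ⟨r, hr⟩ (fun w _ hw => ?_) h1).2
    have : w ∈ G.neighborSet x := hw
    rw [hv] at this
    exact this

lemma cnt_two_leaves {V : Type*} [Finite V] {G : SimpleGraph V} (hG : G.Connected)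
    {n : ℕ} (hn : {v : V | (G.neighborSet v).ncard = 1}.ncard = n + 2) {r v : V} (hrv : v ≠ r)
    (hr : (G.neighborSet r).ncard = 1) (hv : (G.neighborSet v).ncard = 1) :
    2 ^ n ≤ cnt G Set.univ {v, r} := by
  set L := {v : V | (G.neighborSet v).ncard = 1} with hL
  have h1 : (L \ {v, r}).ncard = n := by
    have := Set.ncard_sdiff_add_ncard_of_subset (s := {v, r}) (t := L)
      (by rintro w (rfl | rfl) <;> assumption)
    rw [Set.ncard_pair hrv, hn] at this
    omega
  rw [← h1, ← Set.ncard_powerset, ← Set.ncard_image_of_injective _ compl_injective]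
  refine Set.ncard_le_ncard ?_ (Set.toFinite _)
  rintro _ ⟨K, hK, rfl⟩
  have hK' : K ⊆ L \ {v, r} := hK
  refine ⟨?_, Set.subset_univ _, conn_compl_leaves hG K (fun x hx => (hK' hx).1) r
    (fun h => (hK' h).2 (by simp))⟩
  rintro w hw h
  exact (hK' h).2 hw

lemma closer_unique {V : Type*} {G : SimpleGraph V} (hG : G.IsTree) (r u a b : V)
    (ha : G.Adj u a) (hb : G.Adj u b) (hda : G.dist r a < G.dist r u)
    (hdb : G.dist r b < G.dist r u) : a = b := by
  obtain ⟨q, hq, hq'⟩ := (hG.connected r u).exists_path_of_dist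
  have key : ∀ a, G.Adj u a → G.dist r a < G.dist r u → a = q.penultimate := by
    intro a ha hda
    obtain ⟨p, hp, hp'⟩ := (hG.connected r a).exists_path_of_dist
    apply hG.isAcyclic.eq_penultimate_of_adj_end hq ha
    apply hG.isAcyclic.mem_support_of_ne_mem_support_of_adj_of_isPath hq hp ha
    intro hu
    have := hG.isAcyclic.path_concat hq hp ha hu
    rw [← hp', ← hq', this, Walk.length_concat] at hda
    omega
  rw [key a ha hda, key b hb hdb]

lemma exists_cherry {V : Type*} [Finite V] {G : SimpleGraph V} (hG : G.IsTree)
    (hdeg : ∀ v : V, (G.neighborSet v).ncard = 1 ∨ (G.neighborSet v).ncard = 3)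
    {n : ℕ} (hn : {v : V | (G.neighborSet v).ncard = 1}.ncard = n + 3)
    (r : V) (hr : (G.neighborSet r).ncard = 1) :
    ∃ x y v : V, x ≠ y ∧ x ≠ r ∧ y ≠ r ∧ v ≠ r ∧ (∀ w, G.Adj x w ↔ w = v) ∧
      (∀ w, G.Adj y w ↔ w = v) ∧ (G.neighborSet v).ncard = 3 := by
  have : Nonempty V := ⟨r⟩
  obtain ⟨x, hx⟩ := Finite.exists_max (fun u => G.dist r u)
  -- vertices at maximal distance are leaves
  have far : ∀ u v, (∀ w, G.dist r w ≤ G.dist r u) → G.Adj u v → ∀ w, G.Adj u w ↔ w = v := by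
    intro u v hu huv w
    constructor
    · intro huw
      apply closer_unique hG r u w v huw huv
      · exact lt_of_le_of_ne (hu w) (hG.dist_ne_of_adj r huw).symm
      · exact lt_of_le_of_ne (hu v) (hG.dist_ne_of_adj r huv).symm
    · rintro rfl; exact huv
  obtain ⟨r', hr'⟩ := Set.ncard_eq_one.1 hr
  have hrr : ∀ w, G.Adj r w ↔ w = r' := by
    intro w
    have : w ∈ G.neighborSet r ↔ w = r' := by rw [hr']; simp
    simpa using this
  have hbig : ∃ w, 2 ≤ G.dist r w := by
    by_contra hcon
    push Not at hcon
    have hsub : {v : V | (G.neighborSet v).ncard = 1} ⊆ {r, r'} := by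
      intro w _
      by_cases hw : w = r
      · simp [hw]
      · have h1 := hG.connected.pos_dist_of_ne (Ne.symm hw)
        have h2 := hcon w
        have h3 : G.dist r w = 1 := by omega
        rw [dist_eq_one_iff_adj, hrr] at h3
        simp [h3]
    have h1 := Set.ncard_le_ncard hsub
    have h2 := Set.ncard_insert_le r {r'}
    rw [Set.ncard_singleton] at h2
    omega
  obtain ⟨w0, hw0⟩ := hbig
  have hx2 : 2 ≤ G.dist r x := hw0.trans (hx w0)
  obtain ⟨v, hxv⟩ : ∃ v, G.Adj x v := by
    have : (G.neighborSet x).Nonempty := by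
      rw [← Set.ncard_pos]; rcases hdeg x with h | h <;> omega
    exact this
  have hdv : G.dist r x = G.dist r v + 1 := by
    rcases hG.dist_eq_dist_add_one_of_adj r hxv with h | h
    · exact h
    · have := hx v; omega
  have hvr : v ≠ r := by
    rintro rfl
    rw [SimpleGraph.dist_self] at hdv; omega
  have hv3 : (G.neighborSet v).ncard = 3 := by
    rcases hdeg v with h | h
    · exfalso
      obtain ⟨t, ht⟩ := Set.ncard_eq_one.1 h
      -- v has a neighbour closer to r
      obtain ⟨q, hq'⟩ := hG.connected.exists_walk_length_eq_dist v r
      cases q with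
      | nil => exact hvr rfl
      | @cons _ c _ hadj q' =>
        have h1 : c ∈ G.neighborSet v := hadj
        have h2 : x ∈ G.neighborSet v := hxv.symm
        rw [ht] at h1 h2
        have h3 : c = x := h1.trans h2.symm
        subst h3
        have h4 := G.dist_le q'
        rw [Walk.length_cons, SimpleGraph.dist_comm] at hq'
        rw [SimpleGraph.dist_comm] at h4
        omega
    · exact h
  obtain ⟨y, hyv, hyx, hdy⟩ : ∃ y, G.Adj v y ∧ y ≠ x ∧ G.dist r y = G.dist r x := by
    obtain ⟨a, b, c, hab, hac, hbc, habc⟩ := Set.ncard_eq_three.1 hv3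
    have hadj : ∀ w, G.Adj v w ↔ w = a ∨ w = b ∨ w = c := by
      intro w
      have : w ∈ G.neighborSet v ↔ w = a ∨ w = b ∨ w = c := by rw [habc]; simp
      simpa using this
    by_contra hcon
    push Not at hcon
    have cl : ∀ w, G.Adj v w → w ≠ x → G.dist r w < G.dist r v := by
      intro w hw hwx
      have h1 := hcon w hw hwx
      rcases hG.dist_eq_dist_add_one_of_adj r hw with h | h <;> omega
    have cu : ∀ w w', G.Adj v w → G.Adj v w' → w ≠ x → w' ≠ x → w = w' :=
      fun w w' h1 h2 h3 h4 => closer_unique hG r v w w' h1 h2 (cl w h1 h3) (cl w' h2 h4)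
    have Aa := (hadj a).2 (by simp)
    have Ab := (hadj b).2 (by simp)
    have Ac := (hadj c).2 (by simp)
    by_cases ha : a = x
    · exact hbc (cu b c Ab Ac (fun h => hab (ha.trans h.symm)) (fun h => hac (ha.trans h.symm)))
    · by_cases hb : b = x
      · exact hac (cu a c Aa Ac ha (fun h => hbc (hb.trans h.symm)))
      · exact hab (cu a b Aa Ab ha hb)
  refine ⟨x, y, v, hyx.symm, ?_, ?_, hvr, far x v hx hxv,
    far y v (fun w => hdy ▸ hx w) hyv.symm, hv3⟩
  · rintro rfl; simp at hx2
  · rintro rfl; simp at hdy; omega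

lemma lower_bound (n : ℕ) : ∀ (V : Type) [Finite V] (G : SimpleGraph V), G.IsTree →
      (∀ v : V, (G.neighborSet v).ncard = 1 ∨ (G.neighborSet v).ncard = 3) →
      {v : V | (G.neighborSet v).ncard = 1}.ncard = n + 2 →
      (∀ r, (G.neighborSet r).ncard = 1 → 3 * 2 ^ n ≤ cnt G Set.univ {r} + 1) ∧
      9 * 2 ^ n ≤ cnt G Set.univ ∅ + n + 6 := by
  induction n with
  | zero =>
    intro V _ G hG hdeg hn
    have hne2 : ∀ r, ∃ w, w ≠ r ∧ (G.neighborSet w).ncard = 1 := by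
      intro r
      obtain ⟨w, hw, hwr⟩ := Set.exists_ne_of_one_lt_ncard
        (s := {v : V | (G.neighborSet v).ncard = 1}) (by omega) r
      exact ⟨w, hwr, hw⟩
    have huniv : (G.induce (Set.univ : Set V)).Connected :=
      (induceUnivIso G).connected_iff.2 hG.connected
    constructor
    · intro r _
      obtain ⟨w, hwr, _⟩ := hne2 r
      have hne : ({r} : Set V) ≠ Set.univ := by
        intro h
        have : w ∈ ({r} : Set V) := h ▸ Set.mem_univ w
        exact hwr this
      have : ({{r}, Set.univ} : Set (Set V)).ncard ≤ cnt G Set.univ {r} := by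
        refine Set.ncard_le_ncard ?_ (Set.toFinite _)
        rintro S (rfl | rfl)
        · exact ⟨subset_rfl, Set.subset_univ _, conn_singleton G r⟩
        · exact ⟨Set.subset_univ _, Set.subset_univ _, huniv⟩
      rw [Set.ncard_pair hne] at this
      omega
    · obtain ⟨r⟩ := hG.connected.nonempty
      obtain ⟨w, hwr, hw1⟩ := hne2 r
      obtain ⟨w', hww, hw1'⟩ := hne2 w
      obtain ⟨x, hx⟩ := Set.ncard_eq_one.1 hw1
      have hne : ∀ a b : V, a ≠ b → ({a} : Set V) ≠ Set.univ := by
        intro a b hab h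
        have : b ∈ ({a} : Set V) := h ▸ Set.mem_univ b
        exact hab this.symm
      have : ({{w}, {w'}, Set.univ} : Set (Set V)).ncard ≤ cnt G Set.univ ∅ := by
        refine Set.ncard_le_ncard ?_ (Set.toFinite _)
        rintro S (rfl | rfl | rfl)
        · exact ⟨Set.empty_subset _, Set.subset_univ _, conn_singleton G _⟩
        · exact ⟨Set.empty_subset _, Set.subset_univ _, conn_singleton G _⟩
        · exact ⟨Set.empty_subset _, Set.subset_univ _, huniv⟩
      rw [Set.ncard_eq_three.2 ⟨{w}, {w'}, Set.univ, by simpa using hww.symm,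
        hne w w' hww.symm, hne w' w hww, rfl⟩] at this
      omega
  | succ n ih =>
    intro V _ G hG hdeg hn
    have step : ∀ r, (G.neighborSet r).ncard = 1 →
        3 * 2 ^ (n + 1) ≤ cnt G Set.univ {r} + 1 ∧
        9 * 2 ^ (n + 1) ≤ cnt G Set.univ ∅ + (n + 1) + 6 := by
      intro r hr
      obtain ⟨x, y, v, hxy, hxr, hyr, hvr, hax, hay, hv3⟩ :=
        exists_cherry hG hdeg (n := n) hn r hr
      have hnx : G.neighborSet x = {v} := by ext w; simpa using hax w
      have hny : G.neighborSet y = {v} := by ext w; simpa using hay w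
      have hvx : v ≠ x := ((hax v).2 rfl).ne'
      have hvy : v ≠ y := ((hay v).2 rfl).ne'
      set A : Set V := {x, y}ᶜ with hA
      have memA : ∀ w, w ∈ A ↔ w ≠ x ∧ w ≠ y := by intro w; simp [hA]
      set G' := G.induce A with hG'
      have hvA : v ∈ A := (memA v).2 ⟨hvx, hvy⟩
      have hrA : r ∈ A := (memA r).2 ⟨hxr.symm, hyr.symm⟩
      have hT : G'.IsTree := by
        refine ⟨?_, hG.isAcyclic.induce A⟩
        apply conn_compl_leaves hG.connected {x, y} ?_ v (by simp [hvx, hvy])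
        rintro w (rfl | rfl)
        · rw [hnx]; simp
        · rw [hny]; simp
      have im : ∀ w : A, Subtype.val '' (G'.neighborSet w) = G.neighborSet w.1 \ {x, y} := by
        intro w
        ext z
        constructor
        · rintro ⟨z', hz', rfl⟩
          exact ⟨hz', z'.2⟩
        · rintro ⟨h1, h2⟩
          exact ⟨⟨z, h2⟩, h1, rfl⟩
      have imc : ∀ w : A, (G'.neighborSet w).ncard = (G.neighborSet w.1 \ {x, y}).ncard := by
        intro w
        rw [← im w, Set.ncard_image_of_injective _ Subtype.val_injective]
      have dv : (G'.neighborSet ⟨v, hvA⟩).ncard = 1 := by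
        rw [imc]
        have := Set.ncard_sdiff_add_ncard_of_subset (s := {x, y}) (t := G.neighborSet v)
          (by rintro w (rfl | rfl)
              · exact ((hax v).2 rfl).symm
              · exact ((hay v).2 rfl).symm)
        rw [Set.ncard_pair hxy, hv3] at this
        simp only
        omega
      have dw : ∀ w : A, w.1 ≠ v → (G'.neighborSet w).ncard = (G.neighborSet w.1).ncard := by
        intro w hw
        rw [imc]
        congr 1
        rw [sdiff_eq_left, Set.disjoint_right]
        rintro z (rfl | rfl) hz
        · exact hw ((hax _).1 (G.adj_symm hz))
        · exact hw ((hay _).1 (G.adj_symm hz))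
      have hdeg' : ∀ w : A, (G'.neighborSet w).ncard = 1 ∨ (G'.neighborSet w).ncard = 3 := by
        intro w
        by_cases hw : w.1 = v
        · left
          have : w = ⟨v, hvA⟩ := Subtype.ext hw
          rw [this]; exact dv
        · rw [dw w hw]; exact hdeg w.1
      have hn' : {w : A | (G'.neighborSet w).ncard = 1}.ncard = n + 2 := by
        rw [← Set.ncard_image_of_injective _ Subtype.val_injective]
        have e : Subtype.val '' {w : A | (G'.neighborSet w).ncard = 1} =
            insert v ({v : V | (G.neighborSet v).ncard = 1} \ {x, y}) := by
          ext z
          constructor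
          · rintro ⟨w, hw, rfl⟩
            by_cases hwv : w.1 = v
            · left; exact hwv
            · right
              refine ⟨?_, w.2⟩
              have hw' : (G'.neighborSet w).ncard = 1 := hw
              rw [dw w hwv] at hw'
              exact hw'
          · rintro (rfl | ⟨h1, h2⟩)
            · exact ⟨⟨z, hvA⟩, dv, rfl⟩
            · have hzv : z ≠ v := by
                rintro rfl
                have h1' : (G.neighborSet z).ncard = 1 := h1
                omega
              refine ⟨⟨z, h2⟩, ?_, rfl⟩
              have := dw ⟨z, h2⟩ hzv
              exact this.trans h1
        rw [e, Set.ncard_insert_of_notMem]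
        · have := Set.ncard_sdiff_add_ncard_of_subset (s := {x, y})
            (t := {v : V | (G.neighborSet v).ncard = 1})
            (by rintro w (rfl | rfl)
                · show (G.neighborSet w).ncard = 1
                  rw [hnx]; simp
                · show (G.neighborSet w).ncard = 1
                  rw [hny]; simp)
          rw [Set.ncard_pair hxy, hn] at this
          omega
        · rintro ⟨h1, -⟩
          have h1' : (G.neighborSet v).ncard = 1 := h1
          omega
      obtain ⟨i1, i2⟩ := ih A G' hT hdeg' hn'
      obtain ⟨c1, c2, -⟩ := emb_cherry (Embedding.induce (G := G) A) (x := x) (y := y)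
        (v := ⟨v, hvA⟩) (by intro w; rw [← memA]; simp [Embedding.induce]) hxy hax hay
      have c2' := c2 ⟨r, hrA⟩
      have dr : (G'.neighborSet ⟨r, hrA⟩).ncard = 1 := by
        rw [dw ⟨r, hrA⟩ hvr.symm]; exact hr
      have j1 := i1 _ dr
      have j2 := i1 _ dv
      have j3 := cnt_two_leaves hT.connected hn' (r := ⟨r, hrA⟩) (v := ⟨v, hvA⟩)
        (by intro h; exact hvr (congrArg Subtype.val h)) dr dv
      change cnt G Set.univ {r} = _ at c2'
      rw [c1, c2', pow_succ]
      change 3 * 2 ^ n ≤ cnt (G.induce A) Set.univ _ + 1 at j1 j2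
      change _ ≤ cnt (G.induce A) Set.univ _ at j3
      change _ ≤ cnt (G.induce A) Set.univ _ + n + 6 at i2
      omega
    refine ⟨fun r hr => (step r hr).1, ?_⟩
    obtain ⟨r, hr⟩ : {v : V | (G.neighborSet v).ncard = 1}.Nonempty := by
      rw [← Set.ncard_pos]; omega
    exact (step r hr).2

/-- For `n ≥ 2`, the `n`-leaf binary caterpillar `\hat{T}_{n-2}^3` has
`2^{n+1} + 2^{n-2} - n - 4` subtrees, and it minimizes the number of subtrees among all
binary trees (trees in which every vertex has degree `1` or `3`) with `n` leaves. -/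
theorem binary_caterpillar_min_numSubtrees (n : ℕ) (hn : 2 ≤ n) :
    numSubtrees (caterpillar (n - 2) 3) = 2 ^ (n + 1) + 2 ^ (n - 2) - n - 4 ∧
    ∀ (V : Type) [Fintype V] (G : SimpleGraph V), G.IsTree →
      (∀ v : V, (G.neighborSet v).ncard = 1 ∨ (G.neighborSet v).ncard = 3) →
      {v : V | (G.neighborSet v).ncard = 1}.ncard = n →
      numSubtrees (caterpillar (n - 2) 3) ≤ numSubtrees G := by
  obtain ⟨k, rfl⟩ : ∃ k, n = k + 2 := ⟨n - 2, by omega⟩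
  have hcat : numSubtrees (caterpillar (k + 2 - 2) 3) + k + 6 = 9 * 2 ^ k := by
    rw [Nat.add_sub_cancel]
    unfold numSubtrees
    rw [numSubtrees_aux]
    exact (cat_cnt k).2
  constructor
  · rw [Nat.add_sub_cancel] at hcat ⊢
    have : 2 ^ (k + 2 + 1) = 8 * 2 ^ k := by ring
    omega
  · intro V _ G hG hdeg hn
    have h := (lower_bound k V G hG hdeg hn).2
    have h2 : numSubtrees G = cnt G Set.univ ∅ := numSubtrees_aux G
    omega
end
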